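/- Let n ≥ 2 and let K ⊂ ℝⁿ be a compact convex set with r·D_n ⊆ K ⊆ R·D_n for some 0 < r ≤ R. Then for every λ ∈ (2, ∞) and every unit vector u ∈ S^{n−1}, setting β = (λ−2)/(λ−1) ∈ (0,1), one has A(K, S_u K) ≤ C·(1/β)^{1−1/λ}·(n·R/r)^{1+1/λ}·δ_u(K)^{1/(2λ)}, where C > 0 is a universal constant, δ_u(K) = 1 − |∂S_u K|/|∂K| is the surface area deficit, and A is the Nikodym pseudo-metric. -/

import Mathlib

open MeasureTheory Pointwise Metric Filter

/-- The Steiner symmetral of `K` in direction `u`. -/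
noncomputable def steinerSymmetral {n : ℕ} (u : EuclideanSpace ℝ (Fin n))
    (K : Set (EuclideanSpace ℝ (Fin n))) : Set (EuclideanSpace ℝ (Fin n)) :=
  {z | ∃ (y : EuclideanSpace ℝ (Fin n)) (t : ℝ), y ∈ (ℝ ∙ u)ᗮ ∧
      z = y + t • u ∧ (∃ s : ℝ, y + s • u ∈ K) ∧
      |t| ≤ (volume {s : ℝ | y + s • u ∈ K}).toReal / 2}

/-- The Nikodym pseudo-metric `A(K,T) = inf_{x₀} |(sK) Δ (x₀ + T)| / |T|` with `sⁿ = |T|/|K|`. -/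
noncomputable def nikodym {n : ℕ} (K T : Set (EuclideanSpace ℝ (Fin n))) : ℝ :=
  ⨅ x₀ : EuclideanSpace ℝ (Fin n),
    (volume (symmDiff ((((volume T).toReal / (volume K).toReal) ^ ((1 : ℝ) / n)) • K)
        (x₀ +ᵥ T))).toReal / (volume T).toReal

open scoped ENNReal NNReal

theorem volume_add_le_volume_add_of_isCompact {A B : Set ℝ} (hA : IsCompact A) (hB : IsCompact B)
    (hA' : A.Nonempty) (hB' : B.Nonempty) : volume A + volume B ≤ volume (A + B) := by
  have ha := hA.sSup_mem hA'
  have hb := hB.sInf_mem hB'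
  set a := sSup A
  set b := sInf B
  have h1 : volume ((fun x => x + b) '' A) = volume A := by simp
  have h2 : volume ((fun x => a + x) '' B) = volume B := by simp
  have hd : AEDisjoint volume ((fun x => x + b) '' A) ((fun x => a + x) '' B) := by
    refine measure_mono_null (t := {a + b}) ?_ (by simp)
    rintro z ⟨⟨x, hx, rfl⟩, ⟨y, hy, hz⟩⟩
    have := le_csSup hA.bddAbove hx
    have := csInf_le hB.bddBelow hy
    simp only [Set.mem_singleton_iff]
    simp only [a, b] at *
    linarith
  calc volume A + volume B
      = volume (((fun x => x + b) '' A) ∪ ((fun x => a + x) '' B)) := by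
        rw [measure_union₀ _ hd, h1, h2]
        exact (hB.image (by fun_prop)).measurableSet.nullMeasurableSet
    _ ≤ volume (A + B) := by
        refine measure_mono ?_
        rintro z (⟨x, hx, rfl⟩ | ⟨x, hx, rfl⟩)
        · exact Set.add_mem_add hx hb
        · exact Set.add_mem_add ha hx

/-- The one-dimensional Brunn–Minkowski inequality. -/
theorem volume_add_le_of_forall_mem {A B C : Set ℝ} (hA : MeasurableSet A) (hB : MeasurableSet B)
    (hA' : A.Nonempty) (hB' : B.Nonempty) {a b : ℝ} (ha : 0 < a) (hb : 0 < b)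
    (h : ∀ x ∈ A, ∀ y ∈ B, a * x + b * y ∈ C) :
    ENNReal.ofReal a * volume A + ENNReal.ofReal b * volume B ≤ volume C := by
  have key : ∀ K ⊆ A, IsCompact K → ∀ L ⊆ B, IsCompact L →
      ENNReal.ofReal a * volume K + ENNReal.ofReal b * volume L ≤ volume C := by
    intro K hK hKc L hL hLc
    obtain ⟨x₀, hx₀⟩ := hA'
    obtain ⟨y₀, hy₀⟩ := hB'
    have hc1 : IsCompact (a • insert x₀ K) := (hKc.insert x₀).smul a
    have hc2 : IsCompact (b • insert y₀ L) := (hLc.insert y₀).smul b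
    have := volume_add_le_volume_add_of_isCompact hc1 hc2
      (Set.insert_nonempty _ _).smul_set (Set.insert_nonempty _ _).smul_set
    rw [Measure.addHaar_smul, Measure.addHaar_smul] at this
    simp only [Module.finrank_self, pow_one, abs_of_pos ha, abs_of_pos hb] at this
    calc _ ≤ ENNReal.ofReal a * volume (insert x₀ K) +
          ENNReal.ofReal b * volume (insert y₀ L) := by gcongr <;> exact Set.subset_insert _ _
      _ ≤ _ := this
      _ ≤ _ := by
        refine measure_mono ?_
        rintro z ⟨_, ⟨x, hx, rfl⟩, _, ⟨y, hy, rfl⟩, rfl⟩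
        exact h x (Set.insert_subset hx₀ hK hx) y (Set.insert_subset hy₀ hL hy)
  rw [hA.measure_eq_iSup_isCompact, hB.measure_eq_iSup_isCompact]
  simp only [ENNReal.mul_iSup, iSup_and']
  exact ENNReal.biSup_add_biSup_le' (p := fun K => K ⊆ A ∧ IsCompact K)
    (q := fun L => L ⊆ B ∧ IsCompact L) ⟨∅, Set.empty_subset _, isCompact_empty⟩
    ⟨∅, Set.empty_subset _, isCompact_empty⟩ fun K hK L hL => key K hK.1 hK.2 L hL.1 hL.2

theorem ENNReal.rpow_mul_rpow_le_add {a b : ℝ} (ha : 0 < a) (hb : 0 < b) (hab : a + b = 1)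
    (x y : ℝ≥0∞) : x ^ a * y ^ b ≤ ENNReal.ofReal a * x + ENNReal.ofReal b * y := by
  have hpq : (a⁻¹).HolderConjugate b⁻¹ := by
    rw [Real.holderConjugate_iff]
    refine ⟨?_, by simpa using hab⟩
    exact (one_lt_inv₀ ha).2 (by linarith)
  have := ENNReal.young_inequality (x ^ a) (y ^ b) hpq
  rw [← ENNReal.rpow_mul, ← ENNReal.rpow_mul, mul_inv_cancel₀ ha.ne', mul_inv_cancel₀ hb.ne',
    ENNReal.rpow_one, ENNReal.rpow_one, ENNReal.ofReal_inv_of_pos ha, ENNReal.ofReal_inv_of_pos hb,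
    div_eq_mul_inv, div_eq_mul_inv, inv_inv, inv_inv] at this
  rwa [mul_comm x, mul_comm y] at this

theorem lintegral_eq_lintegral_meas_ofReal_lt {α : Type*} [MeasurableSpace α] (μ : Measure α)
    {k : α → ℝ≥0∞} (hk : Measurable k) (hfin : ∀ x, k x ≠ ∞) :
    ∫⁻ x, k x ∂μ = ∫⁻ s in Set.Ioi (0 : ℝ), μ {x | ENNReal.ofReal s < k x} := by
  have e1 := lintegral_eq_lintegral_meas_lt μ (f := fun x => (k x).toReal)
    (Eventually.of_forall fun x => ENNReal.toReal_nonneg) hk.ennreal_toReal.aemeasurable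
  simp only [ENNReal.ofReal_toReal (hfin _)] at e1
  rw [e1]
  refine setLIntegral_congr_fun measurableSet_Ioi fun s hs => ?_
  simp only [ENNReal.ofReal_lt_iff_lt_toReal (le_of_lt hs) (hfin _)]

theorem prekopaLeindler_real_of_iSup_eq_one {a b : ℝ} (ha : 0 < a) (hb : 0 < b) (hab : a + b = 1)
    {f g h : ℝ → ℝ≥0∞} (hf : Measurable f) (hg : Measurable g) (hh : Measurable h)
    (hf1 : ⨆ x, f x = 1) (hg1 : ⨆ x, g x = 1)
    (H : ∀ x y, f x ^ a * g y ^ b ≤ h (a * x + b * y)) :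
    (∫⁻ x, f x) ^ a * (∫⁻ x, g x) ^ b ≤ ∫⁻ x, h x := by
  have layer : ∀ k : ℝ → ℝ≥0∞, Measurable k → (∀ x, k x ≤ 1) →
      ∫⁻ x, k x = ∫⁻ s in Set.Ioo (0 : ℝ) 1, volume {x | ENNReal.ofReal s < k x} := by
    intro k hk hk1
    have hfin : ∀ x, k x ≠ ∞ := fun x => ((hk1 x).trans_lt ENNReal.one_lt_top).ne
    rw [lintegral_eq_lintegral_meas_ofReal_lt _ hk hfin,
      ← lintegral_indicator measurableSet_Ioi, ← lintegral_indicator measurableSet_Ioo]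
    refine lintegral_congr fun s => ?_
    by_cases hs : 0 < s
    · simp only [Set.indicator, Set.mem_Ioi, hs, Set.mem_Ioo, true_and, if_true]
      split_ifs with h1
      · rfl
      · rw [show {x | ENNReal.ofReal s < k x} = ∅ from ?_, measure_empty]
        refine Set.eq_empty_of_forall_notMem fun x hx => h1 ?_
        simpa using lt_of_lt_of_le hx (hk1 x)
    · simp [Set.indicator, hs]
  have hfle : ∀ x, f x ≤ 1 := fun x => hf1 ▸ le_iSup f x
  have hgle : ∀ x, g x ≤ 1 := fun x => hg1 ▸ le_iSup g x
  calc (∫⁻ x, f x) ^ a * (∫⁻ x, g x) ^ b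
      ≤ ENNReal.ofReal a * (∫⁻ x, f x) + ENNReal.ofReal b * ∫⁻ x, g x :=
        ENNReal.rpow_mul_rpow_le_add ha hb hab _ _
    _ = ∫⁻ s in Set.Ioo (0 : ℝ) 1, (ENNReal.ofReal a * volume {x | ENNReal.ofReal s < f x} +
          ENNReal.ofReal b * volume {x | ENNReal.ofReal s < g x}) := by
        have hm : ∀ k : ℝ → ℝ≥0∞, Measurable fun s : ℝ => volume {x | ENNReal.ofReal s < k x} :=
          fun k => Antitone.measurable fun s t hst => measure_mono fun x hx =>
            (ENNReal.ofReal_le_ofReal hst).trans_lt hx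
        rw [layer f hf hfle, layer g hg hgle, lintegral_add_left ((hm f).const_mul _),
          lintegral_const_mul _ (hm f), lintegral_const_mul _ (hm g)]
    _ ≤ ∫⁻ s in Set.Ioo (0 : ℝ) 1, volume {x | ENNReal.ofReal s < min (h x) 1} := by
        refine setLIntegral_mono' measurableSet_Ioo fun s hs => ?_
        have hs1 : ENNReal.ofReal s < 1 := by simpa using hs.2
        have hf2 : ∃ x, ENNReal.ofReal s < f x := lt_iSup_iff.1 (by rwa [hf1])
        have hg2 : ∃ x, ENNReal.ofReal s < g x := lt_iSup_iff.1 (by rwa [hg1])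
        refine volume_add_le_of_forall_mem (measurableSet_lt measurable_const hf)
          (measurableSet_lt measurable_const hg) hf2 hg2 ha hb
          fun x hx y hy => lt_min ?_ hs1
        refine lt_of_lt_of_le ?_ (H x y)
        calc ENNReal.ofReal s = ENNReal.ofReal s ^ a * ENNReal.ofReal s ^ b := by
              rw [← ENNReal.rpow_add_of_nonneg _ _ ha.le hb.le, hab, ENNReal.rpow_one]
          _ < f x ^ a * g y ^ b := ENNReal.mul_lt_mul (ENNReal.rpow_lt_rpow hx ha)
              (ENNReal.rpow_lt_rpow hy hb)
    _ = ∫⁻ x, min (h x) 1 := (layer _ (hh.min measurable_const) fun x => min_le_right _ _).symm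
    _ ≤ ∫⁻ x, h x := lintegral_mono fun x => min_le_left _ _

theorem prekopaLeindler_real_of_bounded {a b : ℝ} (ha : 0 < a) (hb : 0 < b) (hab : a + b = 1)
    {f g h : ℝ → ℝ≥0∞} (hf : Measurable f) (hg : Measurable g) (hh : Measurable h)
    (hf1 : ⨆ x, f x ≠ ∞) (hg1 : ⨆ x, g x ≠ ∞)
    (H : ∀ x y, f x ^ a * g y ^ b ≤ h (a * x + b * y)) :
    (∫⁻ x, f x) ^ a * (∫⁻ x, g x) ^ b ≤ ∫⁻ x, h x := by
  rcases eq_or_ne (⨆ x, f x) 0 with h0 | hf0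
  · have : ∀ x, f x = 0 := by simpa using h0
    simp [this, ha]
  rcases eq_or_ne (⨆ x, g x) 0 with h0 | hg0
  · have : ∀ x, g x = 0 := by simpa using h0
    simp [this, hb]
  set F := ⨆ x, f x
  set G := ⨆ x, g x
  have key := prekopaLeindler_real_of_iSup_eq_one ha hb hab (hf.const_mul F⁻¹) (hg.const_mul G⁻¹)
    (hh.const_mul (F⁻¹ ^ a * G⁻¹ ^ b)) (by
      rw [← ENNReal.mul_iSup]; exact ENNReal.inv_mul_cancel hf0 hf1) (by
      rw [← ENNReal.mul_iSup]; exact ENNReal.inv_mul_cancel hg0 hg1) (by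
      intro x y
      rw [ENNReal.mul_rpow_of_nonneg _ _ ha.le, ENNReal.mul_rpow_of_nonneg _ _ hb.le,
        mul_mul_mul_comm]
      gcongr
      exact H x y)
  rw [lintegral_const_mul _ hf, lintegral_const_mul _ hg, lintegral_const_mul _ hh,
    ENNReal.mul_rpow_of_nonneg _ _ ha.le, ENNReal.mul_rpow_of_nonneg _ _ hb.le,
        mul_mul_mul_comm] at key
  have c0 : F⁻¹ ^ a * G⁻¹ ^ b ≠ 0 := by
    refine mul_ne_zero ?_ ?_ <;> simp [ENNReal.rpow_eq_zero_iff, hf1, hg1, ha.le, hb.le, not_lt]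
  have c1 : F⁻¹ ^ a * G⁻¹ ^ b ≠ ∞ := by
    refine ENNReal.mul_ne_top ?_ ?_ <;>
      simp [ENNReal.rpow_eq_top_iff, hf0, hg0, ha.le, hb.le, not_lt]
  exact (ENNReal.mul_le_mul_iff_right c0 c1).1 key

/-- The one-dimensional Prékopa–Leindler inequality. -/
theorem prekopaLeindler_real {a b : ℝ} (ha : 0 < a) (hb : 0 < b) (hab : a + b = 1)
    {f g h : ℝ → ℝ≥0∞} (hf : Measurable f) (hg : Measurable g) (hh : Measurable h)
    (H : ∀ x y, f x ^ a * g y ^ b ≤ h (a * x + b * y)) :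
    (∫⁻ x, f x) ^ a * (∫⁻ x, g x) ^ b ≤ ∫⁻ x, h x := by
  rcases eq_or_ne (∫⁻ x, f x) 0 with h0 | hf0
  · simp [h0, ha]
  rcases eq_or_ne (∫⁻ x, g x) 0 with h0 | hg0
  · simp [h0, hb]
  have trunc : ∀ k : ℝ → ℝ≥0∞, Measurable k →
      Tendsto (fun N : ℕ => ∫⁻ x, min (k x) N) atTop (nhds (∫⁻ x, k x)) := by
    intro k hk
    refine lintegral_tendsto_of_tendsto_of_monotone
      (fun N => (hk.min measurable_const).aemeasurable)
      (Eventually.of_forall fun x N M hNM => min_le_min le_rfl (by exact_mod_cast hNM))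
      (Eventually.of_forall fun x => ?_)
    simpa using tendsto_const_nhds.min ENNReal.tendsto_nat_nhds_top
  have lim := ENNReal.Tendsto.mul ((trunc f hf).ennrpow_const a)
    (Or.inl (by simp [ENNReal.rpow_eq_zero_iff, hf0, ha.le, not_lt]))
    ((trunc g hg).ennrpow_const b)
    (Or.inl (by simp [ENNReal.rpow_eq_zero_iff, hg0, hb.le, not_lt]))
  have bdd : ∀ (k : ℝ → ℝ≥0∞) (N : ℕ), ⨆ x, min (k x) (N : ℝ≥0∞) ≠ ∞ := fun k N =>
    ((iSup_le fun x => min_le_right _ _).trans_lt (ENNReal.natCast_lt_top N)).ne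
  refine le_of_tendsto' lim fun N => ?_
  refine prekopaLeindler_real_of_bounded ha hb hab (hf.min measurable_const)
    (hg.min measurable_const) hh (bdd f N) (bdd g N) fun x y => le_trans ?_ (H x y)
  gcongr <;> exact min_le_left _ _

/-- The Prékopa–Leindler inequality. -/
theorem prekopaLeindler_pi {a b : ℝ} (ha : 0 < a) (hb : 0 < b) (hab : a + b = 1) (m : ℕ)
    {f g h : (Fin m → ℝ) → ℝ≥0∞} (hf : Measurable f) (hg : Measurable g) (hh : Measurable h)
    (H : ∀ x y, f x ^ a * g y ^ b ≤ h (a • x + b • y)) :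
    (∫⁻ x, f x) ^ a * (∫⁻ x, g x) ^ b ≤ ∫⁻ x, h x := by
  induction m with
  | zero =>
    rw [Measure.volume_pi_eq_dirac 0, lintegral_dirac, lintegral_dirac, lintegral_dirac]
    simpa using H 0 0
  | succ m ih =>
    have e := (volume_preserving_piFinSuccAbove (fun _ : Fin (m + 1) => ℝ) 0).symm
    have fub : ∀ k : (Fin (m + 1) → ℝ) → ℝ≥0∞, Measurable k →
        ∫⁻ x, k x = ∫⁻ s : ℝ, ∫⁻ y : Fin m → ℝ, k (Fin.cons s y) := by
      intro k hk
      rw [← e.lintegral_comp hk, Measure.volume_eq_prod]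
      refine (lintegral_prod _ (hk.comp e.measurable).aemeasurable).trans
        (lintegral_congr fun s => lintegral_congr fun y => ?_)
      simp [MeasurableEquiv.piFinSuccAbove, Fin.insertNthEquiv]
    have hcons : Measurable fun p : ℝ × (Fin m → ℝ) => (Fin.cons p.1 p.2 : Fin (m + 1) → ℝ) :=
      measurable_pi_iff.2 fun i => by
        refine Fin.cases ?_ (fun j => ?_) i
        · simpa using measurable_fst
        · simpa using! (measurable_pi_apply j).comp measurable_snd
    have hslice : ∀ (k : (Fin (m + 1) → ℝ) → ℝ≥0∞), Measurable k → ∀ s : ℝ,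
        Measurable fun y : Fin m → ℝ => k (Fin.cons s y) := fun k hk s =>
      hk.comp (hcons.comp measurable_prodMk_left)
    have hint : ∀ (k : (Fin (m + 1) → ℝ) → ℝ≥0∞), Measurable k →
        Measurable fun s : ℝ => ∫⁻ y : Fin m → ℝ, k (Fin.cons s y) := fun k hk =>
      (hk.comp hcons).lintegral_prod_right'
    rw [fub f hf, fub g hg, fub h hh]
    refine prekopaLeindler_real ha hb hab (hint f hf) (hint g hg) (hint h hh) fun s t => ?_
    refine ih (hslice f hf s) (hslice g hg t) (hslice h hh _) fun x y => ?_
    convert H (Fin.cons s x) (Fin.cons t y) using 2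
    ext i
    refine Fin.cases ?_ (fun j => ?_) i <;> simp

/-- The multiplicative Brunn–Minkowski inequality. -/
theorem volume_rpow_mul_volume_rpow_le {E : Type*} [NormedAddCommGroup E] [InnerProductSpace ℝ E]
    [FiniteDimensional ℝ E] [MeasurableSpace E] [BorelSpace E] {a b : ℝ} (ha : 0 < a) (hb : 0 < b)
    (hab : a + b = 1) {A B C : Set E} (hA : MeasurableSet A) (hB : MeasurableSet B)
    (hC : MeasurableSet C) (H : ∀ x ∈ A, ∀ y ∈ B, a • x + b • y ∈ C) :
    volume A ^ a * volume B ^ b ≤ volume C := by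
  set e : E ≃ₗᵢ[ℝ] EuclideanSpace ℝ (Fin (Module.finrank ℝ E)) := (stdOrthonormalBasis ℝ E).repr
  have hp : MeasurePreserving (fun x : Fin (Module.finrank ℝ E) → ℝ => e.symm (WithLp.toLp 2 x)) :=
    e.symm.measurePreserving.comp (PiLp.volume_preserving_toLp _)
  have hv : ∀ A : Set E, MeasurableSet A → ∫⁻ x : Fin (Module.finrank ℝ E) → ℝ,
      A.indicator 1 (e.symm (WithLp.toLp 2 x)) = volume A := by
    intro A hA
    rw [hp.lintegral_comp (f := A.indicator 1) (measurable_one.indicator hA),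
      lintegral_indicator_one hA]
  have key := prekopaLeindler_pi ha hb hab _
    ((measurable_one.indicator hA).comp hp.measurable)
    ((measurable_one.indicator hB).comp hp.measurable)
    ((measurable_one.indicator hC).comp hp.measurable) (by
      intro x y
      by_cases hx : e.symm (WithLp.toLp 2 x) ∈ A
      · by_cases hy : e.symm (WithLp.toLp 2 y) ∈ B
        · have := H _ hx _ hy
          simp [Set.indicator, hx, hy, this]
        · simp [Set.indicator, hy, hb]
      · simp [Set.indicator, hx, ha])
  simp only [Function.comp_def] at key
  rwa [hv A hA, hv B hB, hv C hC] at key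

section Poincare

variable {E : Type*} [NormedAddCommGroup E] [InnerProductSpace ℝ E]

/-- The supremum of the positive part of `d` over the points `y` of `Q` such that
`x = (1 - t) y + t z` for some `z` in `Q`. -/
noncomputable def contractionSup (Q : Set E) (d : E → ℝ) (t : ℝ) (x : E) : ℝ≥0∞ :=
  ⨆ (y : E) (z : E) (_ : y ∈ Q ∧ z ∈ Q ∧ x = (1 - t) • y + t • z), ENNReal.ofReal (d y)

theorem lt_contractionSup_iff {Q : Set E} {d : E → ℝ} {t : ℝ} {a : ℝ≥0∞} {x : E} :
    a < contractionSup Q d t x ↔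
      x ∈ (1 - t) • {y | y ∈ Q ∧ a < ENNReal.ofReal (d y)} + t • Q := by
  simp only [contractionSup, lt_iSup_iff, Set.mem_add, Set.mem_smul_set]
  constructor
  · rintro ⟨y, z, ⟨hy, hz, rfl⟩, h⟩
    exact ⟨_, ⟨y, ⟨hy, h⟩, rfl⟩, _, ⟨z, hz, rfl⟩, rfl⟩
  · rintro ⟨_, ⟨y, ⟨hy, h⟩, rfl⟩, _, ⟨z, hz, rfl⟩, rfl⟩
    exact ⟨y, z, ⟨hy, hz, rfl⟩, h⟩

theorem isOpen_lt_contractionSup {Q : Set E} (hQ : IsOpen Q) (d : E → ℝ) {t : ℝ} (ht : t ≠ 0)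
    (a : ℝ≥0∞) : IsOpen {x | a < contractionSup Q d t x} := by
  simp only [lt_contractionSup_iff]
  exact (hQ.smul₀ ht).add_left

theorem contractionSup_le {Q : Set E} {d : E → ℝ} {t ρ B : ℝ} (ht : 0 ≤ t)
    (hρ : ∀ x ∈ Q, ∀ y ∈ Q, ‖x - y‖ ≤ ρ) {x : E}
    (h : ∀ y ∈ Q, ‖y - x‖ ≤ t * ρ → d y - d x ≤ B) :
    contractionSup Q d t x ≤ ENNReal.ofReal (d x) + ENNReal.ofReal B := by
  refine iSup₂_le fun y z => iSup_le fun ⟨hy, hz, hx⟩ => ?_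
  have h1 : y - x = t • (y - z) := by rw [hx]; module
  have h2 : ‖y - x‖ ≤ t * ρ := by
    rw [h1, norm_smul, Real.norm_of_nonneg ht]
    exact mul_le_mul_of_nonneg_left (hρ y hy z hz) ht
  have h3 := h y hy h2
  calc ENNReal.ofReal (d y) ≤ ENNReal.ofReal (d x + B) := ENNReal.ofReal_le_ofReal (by linarith)
    _ ≤ _ := ENNReal.ofReal_add_le

variable [FiniteDimensional ℝ E] [MeasurableSpace E] [BorelSpace E]

theorem lintegral_contractionSup_ge {Q : Set E} (hQ : IsOpen Q)
    {d : E → ℝ} (hd : ContinuousOn d Q) {M : ℝ} (hM : ∀ x ∈ Q, d x ≤ M)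
    (hhalf : 2 * volume {x | x ∈ Q ∧ 0 < d x} ≤ volume Q) {t : ℝ} (ht : 0 < t) (ht1 : t < 1) :
    ENNReal.ofReal (1 + t / 2) * ∫⁻ x, Q.indicator (fun x => ENNReal.ofReal (d x)) x ≤
      ∫⁻ x, contractionSup Q d t x := by
  have hlt : ∀ (s : ℝ≥0∞) x, s < Q.indicator (fun x => ENNReal.ofReal (d x)) x ↔
      x ∈ Q ∧ s < ENNReal.ofReal (d x) := by
    intro s x
    by_cases hx : x ∈ Q <;> simp [hx]
  have hopen : ∀ s : ℝ≥0∞, IsOpen {x | x ∈ Q ∧ s < ENNReal.ofReal (d x)} := fun s =>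
    (ENNReal.continuous_ofReal.comp_continuousOn hd).isOpen_inter_preimage hQ isOpen_Ioi
  have hum : Measurable (Q.indicator (fun x => ENNReal.ofReal (d x))) := by
    refine measurable_of_Ioi fun s => ?_
    simp only [Set.preimage, Set.mem_Ioi, hlt]
    exact (hopen s).measurableSet
  have hUm : Measurable (contractionSup Q d t) :=
    measurable_of_Ioi fun s => (isOpen_lt_contractionSup hQ d ht.ne' s).measurableSet
  rw [lintegral_eq_lintegral_meas_ofReal_lt _ hum, lintegral_eq_lintegral_meas_ofReal_lt _ hUm]
  · rw [← lintegral_const_mul']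
    swap; · exact ENNReal.ofReal_ne_top
    refine setLIntegral_mono' measurableSet_Ioi fun s hs => ?_
    simp only [hlt]
    set G := {x | x ∈ Q ∧ ENNReal.ofReal s < ENNReal.ofReal (d x)} with hG
    have hGQ : 2 * volume G ≤ volume Q := by
      refine le_trans ?_ hhalf
      gcongr
      intro x hx
      have hs' : (0 : ℝ) < s := hs
      exact ⟨hx.1, hs'.trans (ENNReal.ofReal_lt_ofReal_iff'.1 hx.2).1⟩
    have bm := volume_rpow_mul_volume_rpow_le (a := 1 - t) (b := t) (A := G) (B := Q)
      (C := {x | ENNReal.ofReal s < contractionSup Q d t x}) (by linarith) ht (by ring)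
      (hopen _).measurableSet hQ.measurableSet
      (isOpen_lt_contractionSup hQ d ht.ne' _).measurableSet
      fun x hx y hy => lt_contractionSup_iff.2
        ⟨_, ⟨x, hx, rfl⟩, _, ⟨y, hy, rfl⟩, rfl⟩
    refine le_trans ?_ bm
    have h2 : ENNReal.ofReal (1 + t / 2) ≤ 2 ^ t := by
      rw [show (2 : ℝ≥0∞) = ENNReal.ofReal 2 by simp, ENNReal.ofReal_rpow_of_pos two_pos]
      refine ENNReal.ofReal_le_ofReal ?_
      rw [Real.rpow_def_of_pos two_pos]
      have := Real.add_one_le_exp (Real.log 2 * t)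
      have := Real.log_two_gt_d9
      nlinarith
    calc ENNReal.ofReal (1 + t / 2) * volume G ≤ 2 ^ t * volume G := by gcongr
      _ = volume G ^ (1 - t) * (2 * volume G) ^ t := by
        rw [ENNReal.mul_rpow_of_nonneg _ _ ht.le, mul_left_comm,
          ← ENNReal.rpow_add_of_nonneg _ _ (by linarith) ht.le]
        simp
      _ ≤ _ := by gcongr
  · intro x
    refine (lt_of_le_of_lt (b := ENNReal.ofReal M) ?_ ENNReal.ofReal_lt_top).ne
    exact iSup₂_le fun y z => iSup_le fun h => ENNReal.ofReal_le_ofReal (hM y h.1)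
  · intro x
    by_cases hx : x ∈ Q <;> simp [hx]

theorem lintegral_ofReal_le_lintegral_fderiv {Q : Set E} (hQ : IsOpen Q) (hQc : Convex ℝ Q)
    {ρ : ℝ} (hρ : ∀ x ∈ Q, ∀ y ∈ Q, ‖x - y‖ ≤ ρ) {d : E → ℝ} {C : ℝ≥0}
    (hd : LipschitzOnWith C d Q) (hhalf : 2 * volume {x | x ∈ Q ∧ 0 < d x} ≤ volume Q) :
    ∫⁻ x in Q, ENNReal.ofReal (d x) ≤ ENNReal.ofReal (2 * ρ) * ∫⁻ x in Q, ‖fderiv ℝ d x‖ₑ := by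
  rcases Q.eq_empty_or_nonempty with rfl | ⟨x₀, hx₀⟩
  · simp
  have hρ0 : 0 ≤ ρ := (norm_nonneg _).trans (hρ x₀ hx₀ x₀ hx₀)
  have hQv : volume Q ≠ ∞ := by
    refine (Bornology.IsBounded.measure_lt_top ?_).ne
    refine (isBounded_closedBall (x := x₀) (r := ρ)).subset fun x hx => ?_
    rw [mem_closedBall, dist_eq_norm]
    exact hρ x hx x₀ hx₀
  have hlip : ∀ x ∈ Q, ∀ y ∈ Q, d y - d x ≤ C * ‖y - x‖ := fun x hx y hy => by
    have := hd.dist_le_mul y hy x hx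
    rw [Real.dist_eq, dist_eq_norm] at this
    exact (le_abs_self _).trans this
  have hM : ∀ x ∈ Q, d x ≤ d x₀ + C * ρ := fun x hx => by
    have := hlip x₀ hx₀ x hx
    have := mul_le_mul_of_nonneg_left (hρ x hx x₀ hx₀) C.coe_nonneg
    linarith
  set u := Q.indicator (fun x => ENNReal.ofReal (d x)) with hu
  have hum : Measurable u := by
    refine measurable_of_Ioi fun s => ?_
    have : u ⁻¹' Set.Ioi s = Q ∩ (fun x => ENNReal.ofReal (d x)) ⁻¹' Set.Ioi s := by
      ext x
      by_cases hx : x ∈ Q <;> simp [hu, hx]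
    rw [this]
    exact ((ENNReal.continuous_ofReal.comp_continuousOn hd.continuousOn).isOpen_inter_preimage
      hQ isOpen_Ioi).measurableSet
  have hufin : ∫⁻ x, u x ≠ ∞ := by
    rw [hu, lintegral_indicator hQ.measurableSet]
    refine (lt_of_le_of_lt (setLIntegral_mono' (g := fun _ => ENNReal.ofReal (d x₀ + C * ρ))
      hQ.measurableSet fun x hx => ENNReal.ofReal_le_ofReal (hM x hx)) ?_).ne
    rw [setLIntegral_const]
    exact ENNReal.mul_lt_top ENNReal.ofReal_lt_top hQv.lt_top
  set τ : ℕ → ℝ := fun k => 1 / ((k : ℝ) + 2) with hτ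
  have hτ0 : ∀ k, 0 < τ k := fun k => by positivity
  have hτ1 : ∀ k, τ k < 1 := fun k => by
    rw [hτ]; simp only; rw [div_lt_one (by positivity)]
    have : (0 : ℝ) ≤ k := k.cast_nonneg
    linarith
  have hτl : Tendsto τ atTop (nhds 0) := by
    have := (tendsto_one_div_add_atTop_nhds_zero_nat (𝕜 := ℝ)).comp (tendsto_add_atTop_nat 1)
    refine this.congr fun k => ?_
    simp only [Function.comp, hτ]
    push_cast; ring
  set V : ℕ → E → ℝ≥0∞ := fun k x =>
    (ENNReal.ofReal (τ k))⁻¹ * (contractionSup Q d (τ k) x - u x) with hV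
  have hUm : ∀ k, Measurable (contractionSup Q d (τ k)) := fun k =>
    measurable_of_Ioi fun s => (isOpen_lt_contractionSup hQ d (hτ0 k).ne' s).measurableSet
  have hVm : ∀ k, Measurable (V k) := fun k => ((hUm k).sub hum).const_mul _
  have hout : ∀ k, ∀ x ∉ Q, V k x = 0 := by
    intro k x hx
    have : contractionSup Q d (τ k) x = 0 := by
      refine le_antisymm (iSup₂_le fun y z => iSup_le fun h => absurd ?_ hx) zero_le
      rw [h.2.2]
      exact hQc h.1 h.2.1 (by linarith [hτ1 k]) (hτ0 k).le (by ring)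
    simp [hV, this]
  have hle : ∀ k, ∀ x ∈ Q, ∀ B : ℝ,
      (∀ y ∈ Q, ‖y - x‖ ≤ τ k * ρ → d y - d x ≤ τ k * B) → V k x ≤ ENNReal.ofReal B := by
    intro k x hx B h
    have h1 := contractionSup_le (hτ0 k).le hρ h
    have hux : u x = ENNReal.ofReal (d x) := by simp [hu, hx]
    rw [← hux] at h1
    calc V k x ≤ (ENNReal.ofReal (τ k))⁻¹ * ENNReal.ofReal (τ k * B) := by
          simp only [hV]; gcongr; exact tsub_le_iff_left.2 h1
      _ = ENNReal.ofReal B := by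
        rw [ENNReal.ofReal_mul (hτ0 k).le, ← mul_assoc, ENNReal.inv_mul_cancel, one_mul]
        · simpa using hτ0 k
        · exact ENNReal.ofReal_ne_top
  have hlow : ∀ k, ENNReal.ofReal (1 / 2) * ∫⁻ x, u x ≤ ∫⁻ x in Q, V k x := by
    intro k
    have h1 := lintegral_contractionSup_ge hQ hd.continuousOn hM hhalf (hτ0 k) (hτ1 k)
    rw [← hu, ENNReal.ofReal_add zero_le_one (by have := hτ0 k; positivity), ENNReal.ofReal_one,
      add_mul, one_mul] at h1
    have h2 : ∫⁻ x in Q, V k x = ∫⁻ x, V k x := by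
      rw [← lintegral_indicator hQ.measurableSet]
      refine lintegral_congr fun x => ?_
      by_cases hx : x ∈ Q <;> simp [hx, hout]
    rw [h2]
    simp only [hV]
    rw [lintegral_const_mul' _ _ (by simpa using hτ0 k)]
    have h3 : ENNReal.ofReal (τ k / 2) * ∫⁻ x, u x ≤
        ∫⁻ x, (contractionSup Q d (τ k) x - u x) := by
      refine le_trans ?_ (lintegral_sub_le _ _ hum)
      exact ENNReal.le_sub_of_add_le_left hufin h1
    calc ENNReal.ofReal (1 / 2) * ∫⁻ x, u x
        = (ENNReal.ofReal (τ k))⁻¹ * (ENNReal.ofReal (τ k / 2) * ∫⁻ x, u x) := by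
          rw [← mul_assoc, div_eq_mul_one_div (τ k), ENNReal.ofReal_mul (hτ0 k).le, ← mul_assoc,
            ENNReal.inv_mul_cancel, one_mul]
          · simpa using hτ0 k
          · exact ENNReal.ofReal_ne_top
      _ ≤ _ := by gcongr
  have hlim : ∀ᵐ x ∂(volume.restrict Q),
      limsup (fun k => V k x) atTop ≤ ENNReal.ofReal ρ * ‖fderiv ℝ d x‖ₑ := by
    rw [ae_restrict_iff' hQ.measurableSet]
    filter_upwards [hd.ae_differentiableWithinAt_of_mem (μ := volume)] with x hx hxQ
    have hdx := ((hx hxQ).differentiableAt (hQ.mem_nhds hxQ)).hasFDerivAt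
    have hη : ∀ η : ℝ, 0 < η →
        limsup (fun k => V k x) atTop ≤ ENNReal.ofReal (ρ * (‖fderiv ℝ d x‖ + η)) := by
      intro η hη
      refine limsup_le_of_le (by isBoundedDefault) ?_
      have h1 := hdx.isLittleO.def hη
      rw [Metric.eventually_nhds_iff] at h1
      obtain ⟨ε, hε, h1⟩ := h1
      have h2 : ∀ᶠ k in atTop, τ k * ρ < ε := by
        have := hτl.mul_const ρ
        rw [zero_mul] at this
        exact this.eventually_lt_const hε
      filter_upwards [h2] with k hk
      refine hle k x hxQ _ fun y hy hyx => ?_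
      have h3 := h1 (y := y) (by rw [dist_eq_norm]; linarith)
      have h4 : d y - d x ≤ (‖fderiv ℝ d x‖ + η) * ‖y - x‖ := by
        have := (fderiv ℝ d x).le_opNorm (y - x)
        have h5 := (le_abs_self _).trans this
        have h6 := (le_abs_self _).trans h3
        linarith
      calc d y - d x ≤ (‖fderiv ℝ d x‖ + η) * ‖y - x‖ := h4
        _ ≤ (‖fderiv ℝ d x‖ + η) * (τ k * ρ) := by gcongr
        _ = _ := by ring
    have h7 : Tendsto (fun η : ℝ => ENNReal.ofReal (ρ * (‖fderiv ℝ d x‖ + η)))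
        (nhdsWithin 0 (Set.Ioi 0)) (nhds (ENNReal.ofReal (ρ * (‖fderiv ℝ d x‖ + 0)))) := by
      refine ((ENNReal.continuous_ofReal.comp (by fun_prop : Continuous fun η : ℝ =>
        ρ * (‖fderiv ℝ d x‖ + η))).tendsto 0).mono_left nhdsWithin_le_nhds
    have h8 := ge_of_tendsto h7 (by filter_upwards [self_mem_nhdsWithin] with η h using hη η h)
    rwa [add_zero, ENNReal.ofReal_mul hρ0, ofReal_norm] at h8
  have fatou := limsup_lintegral_le (μ := volume.restrict Q) (f := V)
    (fun _ => ENNReal.ofReal (C * ρ)) hVm (fun k => by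
      rw [EventuallyLE, ae_restrict_iff' hQ.measurableSet]
      refine Eventually.of_forall fun x hx => hle k x hx _ fun y hy hyx => ?_
      have := mul_le_mul_of_nonneg_left hyx C.coe_nonneg
      linarith [hlip x hx y hy]) (by
      rw [setLIntegral_const]
      exact ENNReal.mul_ne_top ENNReal.ofReal_ne_top hQv)
  have h9 : ENNReal.ofReal (1 / 2) * ∫⁻ x, u x ≤
      limsup (fun k => ∫⁻ x in Q, V k x) atTop :=
    le_limsup_of_frequently_le (Eventually.of_forall hlow).frequently (by isBoundedDefault)
  have h10 : ENNReal.ofReal (1 / 2) * ∫⁻ x, u x ≤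
      ENNReal.ofReal ρ * ∫⁻ x in Q, ‖fderiv ℝ d x‖ₑ := by
    refine (h9.trans fatou).trans ((lintegral_mono_ae hlim).trans ?_)
    rw [lintegral_const_mul' _ _ ENNReal.ofReal_ne_top]
  rw [hu, lintegral_indicator hQ.measurableSet] at h10
  calc ∫⁻ x in Q, ENNReal.ofReal (d x)
      = ENNReal.ofReal 2 * (ENNReal.ofReal (1 / 2) * ∫⁻ x in Q, ENNReal.ofReal (d x)) := by
        rw [← mul_assoc, ← ENNReal.ofReal_mul zero_le_two]; simp
    _ ≤ ENNReal.ofReal 2 * (ENNReal.ofReal ρ * ∫⁻ x in Q, ‖fderiv ℝ d x‖ₑ) := by gcongr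
    _ = _ := by rw [← mul_assoc, ← ENNReal.ofReal_mul zero_le_two]

theorem exists_median {Q : Set E} (hQ : IsOpen Q) (hQv : volume Q ≠ ∞) {d : E → ℝ}
    (hd : ContinuousOn d Q) {M : ℝ} (hM : ∀ x ∈ Q, |d x| ≤ M) :
    ∃ c, 2 * volume {x | x ∈ Q ∧ c < d x} ≤ volume Q ∧
      2 * volume {x | x ∈ Q ∧ d x < c} ≤ volume Q := by
  rcases Q.eq_empty_or_nonempty with rfl | ⟨x₀, hx₀⟩
  · simp
  have hQ0 : volume Q ≠ 0 := (hQ.measure_pos _ ⟨x₀, hx₀⟩).ne'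
  set T := {c : ℝ | 2 * volume {x | x ∈ Q ∧ c < d x} ≤ volume Q} with hT
  have hTM : M ∈ T := by
    have : {x | x ∈ Q ∧ M < d x} = ∅ :=
      Set.eq_empty_of_forall_notMem fun x hx => ((le_abs_self _).trans (hM x hx.1)).not_gt hx.2
    simp [hT, this]
  have hTb : BddBelow T := by
    refine ⟨-M - 1, fun c hc => ?_⟩
    by_contra! h
    have : {x | x ∈ Q ∧ c < d x} = Q := by
      ext x
      refine ⟨fun h => h.1, fun hx => ⟨hx, ?_⟩⟩
      linarith [neg_le_of_abs_le (hM x hx)]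
    rw [hT, Set.mem_ofPred_eq, this, two_mul] at hc
    have h3 : volume Q < volume Q + volume Q := ENNReal.lt_add_right hQv hQ0
    exact hc.not_gt h3
  refine ⟨sInf T, ?_, ?_⟩
  · obtain ⟨v, hv, hvl, hvT⟩ := exists_seq_tendsto_sInf ⟨M, hTM⟩ hTb
    have h1 : {x | x ∈ Q ∧ sInf T < d x} = ⋃ k, {x | x ∈ Q ∧ v k < d x} := by
      ext x
      simp only [Set.mem_ofPred_eq, Set.mem_iUnion]
      constructor
      · rintro ⟨hx, h⟩
        obtain ⟨k, hk⟩ := (hvl.eventually_lt_const h).exists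
        exact ⟨k, hx, hk⟩
      · rintro ⟨k, hx, h⟩
        exact ⟨hx, (csInf_le hTb (hvT k)).trans_lt h⟩
    rw [h1, Monotone.measure_iUnion, ENNReal.mul_iSup]
    · exact iSup_le hvT
    · exact fun i j hij x hx => ⟨hx.1, (hv hij).trans_lt hx.2⟩
  · have h1 : {x | x ∈ Q ∧ d x < sInf T} = ⋃ k : ℕ, {x | x ∈ Q ∧ d x ≤ sInf T - 1 / (k + 1)} := by
      ext x
      simp only [Set.mem_ofPred_eq, Set.mem_iUnion]
      constructor
      · rintro ⟨hx, h⟩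
        obtain ⟨k, hk⟩ := exists_nat_one_div_lt (sub_pos.2 h)
        exact ⟨k, hx, by linarith⟩
      · rintro ⟨k, hx, h⟩
        exact ⟨hx, h.trans_lt (sub_lt_self _ (by positivity))⟩
    rw [h1, Monotone.measure_iUnion, ENNReal.mul_iSup]
    · refine iSup_le fun k => ?_
      have hk : sInf T - 1 / ((k : ℝ) + 1) ∉ T :=
        notMem_of_lt_csInf (sub_lt_self _ (by positivity)) hTb
      have hk' : volume Q < 2 * volume {x | x ∈ Q ∧ sInf T - 1 / ((k : ℝ) + 1) < d x} :=
        not_le.1 hk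
      have hsum : volume {x | x ∈ Q ∧ d x ≤ sInf T - 1 / ((k : ℝ) + 1)} +
          volume {x | x ∈ Q ∧ sInf T - 1 / ((k : ℝ) + 1) < d x} = volume Q := by
        rw [← measure_union]
        · congr 1
          ext x
          simp only [Set.mem_union, Set.mem_ofPred_eq, ← and_or_left, le_or_gt, and_true]
        · exact Set.disjoint_left.2 fun x hx hx' => hx.2.not_gt hx'.2
        · exact (hd.isOpen_inter_preimage hQ isOpen_Ioi).measurableSet
      by_contra! h
      have h4 := ENNReal.add_lt_add h hk'
      rw [← mul_add, hsum, two_mul] at h4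
      exact h4.false
    · intro i j hij x hx
      refine ⟨hx.1, hx.2.trans ?_⟩
      have : 1 / ((j : ℝ) + 1) ≤ 1 / ((i : ℝ) + 1) := Nat.one_div_le_one_div hij
      linarith

/-- A Poincaré inequality in `L¹` on bounded open convex sets. -/
theorem exists_lintegral_abs_sub_le_lintegral_fderiv {Q : Set E} (hQ : IsOpen Q)
    (hQc : Convex ℝ Q) {ρ : ℝ} (hρ : ∀ x ∈ Q, ∀ y ∈ Q, ‖x - y‖ ≤ ρ) {d : E → ℝ} {C : ℝ≥0}
    (hd : LipschitzOnWith C d Q) :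
    ∃ c, ∫⁻ x in Q, ENNReal.ofReal |d x - c| ≤
      ENNReal.ofReal (4 * ρ) * ∫⁻ x in Q, ‖fderiv ℝ d x‖ₑ := by
  rcases Q.eq_empty_or_nonempty with rfl | ⟨x₀, hx₀⟩
  · simp
  have hρ0 : 0 ≤ ρ := (norm_nonneg _).trans (hρ x₀ hx₀ x₀ hx₀)
  have hQv : volume Q ≠ ∞ := by
    refine (Bornology.IsBounded.measure_lt_top ?_).ne
    refine (isBounded_closedBall (x := x₀) (r := ρ)).subset fun x hx => ?_
    rw [mem_closedBall, dist_eq_norm]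
    exact hρ x hx x₀ hx₀
  obtain ⟨c, hc1, hc2⟩ := exists_median hQ hQv hd.continuousOn (M := |d x₀| + C * ρ)
    fun x hx => by
      have h1 := hd.dist_le_mul x hx x₀ hx₀
      rw [Real.dist_eq, dist_eq_norm] at h1
      have h2 := mul_le_mul_of_nonneg_left (hρ x hx x₀ hx₀) C.coe_nonneg
      have h3 := abs_sub_abs_le_abs_sub (d x) (d x₀)
      linarith
  have h1 := lintegral_ofReal_le_lintegral_fderiv hQ hQc hρ (d := fun x => d x - c) (C := C)
    (by simpa [LipschitzOnWith] using hd) (by simpa using hc1)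
  have h2 := lintegral_ofReal_le_lintegral_fderiv hQ hQc hρ (d := fun x => c - d x) (C := C)
    (by simpa [LipschitzOnWith] using hd) (by simpa using hc2)
  simp only [fderiv_sub_const, fderiv_const_sub, enorm_neg] at h1 h2
  refine ⟨c, ?_⟩
  calc ∫⁻ x in Q, ENNReal.ofReal |d x - c|
      ≤ ∫⁻ x in Q, (ENNReal.ofReal (d x - c) + ENNReal.ofReal (c - d x)) := by
        refine lintegral_mono fun x => ?_
        rcases abs_cases (d x - c) with h | h
        · simp only [h.1]; exact le_self_add
        · simp only [h.1, neg_sub]; exact le_add_self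
    _ = (∫⁻ x in Q, ENNReal.ofReal (d x - c)) + ∫⁻ x in Q, ENNReal.ofReal (c - d x) := by
        refine lintegral_add_left' (ENNReal.measurable_ofReal.comp_aemeasurable ?_) _
        exact (hd.continuousOn.sub continuousOn_const).aemeasurable hQ.measurableSet
    _ ≤ _ := add_le_add h1 h2
    _ = _ := by
        rw [← add_mul, ← ENNReal.ofReal_add (by positivity) (by positivity)]
        ring_nf

end Poincare

section Sections

variable {V : Type*} [NormedAddCommGroup V] [InnerProductSpace ℝ V]

/-- The section of `M` by the line through `y` with direction `u`. -/
def lineSection (u : V) (M : Set V) (y : (ℝ ∙ u)ᗮ) : Set ℝ := {s | (y : V) + s • u ∈ M}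

/-- The upper endpoint of a section. -/
noncomputable def sectionTop (u : V) (K : Set V) (y : (ℝ ∙ u)ᗮ) : ℝ := sSup (lineSection u K y)

/-- The lower endpoint of a section. -/
noncomputable def sectionBot (u : V) (K : Set V) (y : (ℝ ∙ u)ᗮ) : ℝ := sInf (lineSection u K y)

/-- The orthogonal projection of `K` to the complement of `u`. -/
def shadow (u : V) (K : Set V) : Set (ℝ ∙ u)ᗮ := {y | (lineSection u K y).Nonempty}

variable {u : V} {K : Set V}

theorem norm_sq_coe_add_smul (hu : ‖u‖ = 1) (y : (ℝ ∙ u)ᗮ) (s : ℝ) :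
    ‖(y : V) + s • u‖ ^ 2 = ‖y‖ ^ 2 + s ^ 2 := by
  have h : inner ℝ (y : V) (s • u) = 0 := by
    have := (Submodule.mem_orthogonal' _ _).1 y.2 (s • u)
      (Submodule.smul_mem _ _ (Submodule.mem_span_singleton_self u))
    exact this
  rw [norm_add_sq_real, h, norm_smul, hu]
  simp

theorem isCompact_lineSection (hu : ‖u‖ = 1) (hK : IsCompact K) (y : (ℝ ∙ u)ᗮ) :
    IsCompact (lineSection u K y) := by
  have hiso : Isometry fun s : ℝ => (y : V) + s • u :=
    Isometry.of_dist_eq fun s t => by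
      rw [dist_add_left, dist_eq_norm, ← sub_smul, norm_smul, hu, mul_one, dist_eq_norm]
  exact hiso.isClosedEmbedding.isCompact_preimage hK

theorem convex_lineSection (hK : Convex ℝ K) (y : (ℝ ∙ u)ᗮ) : Convex ℝ (lineSection u K y) := by
  intro s hs t ht a b ha hb hab
  have := hK hs ht ha hb hab
  have e : (y : V) + (a • s + b • t) • u = a • ((y : V) + s • u) + b • ((y : V) + t • u) := by
    have : (y : V) = (a + b) • (y : V) := by rw [hab, one_smul]
    rw [smul_eq_mul, smul_eq_mul]
    nth_rewrite 1 [this]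
    module
  change (y : V) + (a • s + b • t) • u ∈ K
  rwa [e]

theorem lineSection_eq_Icc (hu : ‖u‖ = 1) (hK : IsCompact K) (hKc : Convex ℝ K)
    {y : (ℝ ∙ u)ᗮ} (hy : y ∈ shadow u K) :
    lineSection u K y = Set.Icc (sectionBot u K y) (sectionTop u K y) :=
  eq_Icc_of_connected_compact ⟨hy, (convex_lineSection hKc y).isPreconnected⟩
    (isCompact_lineSection hu hK y)

theorem sectionTop_mem (hu : ‖u‖ = 1) (hK : IsCompact K) {y : (ℝ ∙ u)ᗮ} (hy : y ∈ shadow u K) :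
    (y : V) + sectionTop u K y • u ∈ K := (isCompact_lineSection hu hK y).sSup_mem hy

theorem sectionBot_mem (hu : ‖u‖ = 1) (hK : IsCompact K) {y : (ℝ ∙ u)ᗮ} (hy : y ∈ shadow u K) :
    (y : V) + sectionBot u K y • u ∈ K := (isCompact_lineSection hu hK y).sInf_mem hy

theorem le_sectionTop (hu : ‖u‖ = 1) (hK : IsCompact K) {y : (ℝ ∙ u)ᗮ} {s : ℝ}
    (hs : (y : V) + s • u ∈ K) : s ≤ sectionTop u K y :=
  le_csSup (isCompact_lineSection hu hK y).bddAbove hs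

theorem sectionBot_le (hu : ‖u‖ = 1) (hK : IsCompact K) {y : (ℝ ∙ u)ᗮ} {s : ℝ}
    (hs : (y : V) + s • u ∈ K) : sectionBot u K y ≤ s :=
  csInf_le (isCompact_lineSection hu hK y).bddBelow hs

theorem sectionBot_le_sectionTop (hu : ‖u‖ = 1) (hK : IsCompact K) {y : (ℝ ∙ u)ᗮ}
    (hy : y ∈ shadow u K) : sectionBot u K y ≤ sectionTop u K y :=
  sectionBot_le hu hK (sectionTop_mem hu hK hy)

theorem volume_lineSection (hu : ‖u‖ = 1) (hK : IsCompact K) (hKc : Convex ℝ K)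
    {y : (ℝ ∙ u)ᗮ} (hy : y ∈ shadow u K) :
    volume (lineSection u K y) = ENNReal.ofReal (sectionTop u K y - sectionBot u K y) := by
  rw [lineSection_eq_Icc hu hK hKc hy, Real.volume_Icc]

theorem concaveOn_sectionTop (hu : ‖u‖ = 1) (hK : IsCompact K) (hKc : Convex ℝ K) :
    ConcaveOn ℝ (shadow u K) (sectionTop u K) := by
  have key : ∀ ⦃y z : (ℝ ∙ u)ᗮ⦄, y ∈ shadow u K → z ∈ shadow u K → ∀ ⦃a b : ℝ⦄, 0 ≤ a → 0 ≤ b →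
      a + b = 1 → ((a • y + b • z : (ℝ ∙ u)ᗮ) : V) +
        (a * sectionTop u K y + b * sectionTop u K z) • u ∈ K := by
    intro y z hy hz a b ha hb hab
    have := hKc (sectionTop_mem hu hK hy) (sectionTop_mem hu hK hz) ha hb hab
    convert this using 1
    push_cast
    module
  exact ⟨fun y hy z hz a b ha hb hab => ⟨_, key hy hz ha hb hab⟩,
    fun y hy z hz a b ha hb hab => le_sectionTop hu hK (key hy hz ha hb hab)⟩

theorem convexOn_sectionBot (hu : ‖u‖ = 1) (hK : IsCompact K) (hKc : Convex ℝ K) :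
    ConvexOn ℝ (shadow u K) (sectionBot u K) := by
  refine ⟨(concaveOn_sectionTop hu hK hKc).1, fun y hy z hz a b ha hb hab =>
    sectionBot_le hu hK ?_⟩
  have := hKc (sectionBot_mem hu hK hy) (sectionBot_mem hu hK hz) ha hb hab
  convert this using 1
  simp only [smul_eq_mul]
  push_cast
  module

theorem lineSection_add_subset (t : ℝ) (y : (ℝ ∙ u)ᗮ) :
    lineSection u K y ⊆ lineSection u (K + t • closedBall (0 : V) 1) y := by
  intro s hs
  refine ⟨_, hs, 0, ?_, add_zero _⟩
  exact ⟨0, by simp, by simp⟩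

theorem coe_add_smul_mem_add_closedBall_iff (hu : ‖u‖ = 1) {t : ℝ} (ht : 0 ≤ t) {y : (ℝ ∙ u)ᗮ}
    {s : ℝ} : (y : V) + s • u ∈ K + t • closedBall (0 : V) 1 ↔
      ∃ (z : (ℝ ∙ u)ᗮ) (s' : ℝ), (z : V) + s' • u ∈ K ∧ ‖y - z‖ ^ 2 + (s - s') ^ 2 ≤ t ^ 2 := by
  have hB : t • closedBall (0 : V) 1 = closedBall 0 t := by
    rw [smul_unitClosedBall, Real.norm_of_nonneg ht]
  rw [hB]
  constructor
  · rintro ⟨k, hk, b, hb, hkb⟩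
    obtain ⟨z', hz', w, hw, hk'⟩ := Submodule.exists_add_mem_mem_orthogonal (K := ℝ ∙ u) k
    obtain ⟨s', rfl⟩ := Submodule.mem_span_singleton.1 hz'
    refine ⟨⟨w, hw⟩, s', by rw [add_comm]; rwa [← hk'], ?_⟩
    rw [← norm_sq_coe_add_smul hu]
    have : ((y - ⟨w, hw⟩ : (ℝ ∙ u)ᗮ) : V) + (s - s') • u = b := by
      have : b = (y : V) + s • u - k := by rw [← hkb]; simp
      rw [this, hk']
      push_cast
      module
    rw [this]
    exact pow_le_pow_left₀ (norm_nonneg _) (by simpa using hb) 2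
  · rintro ⟨z, s', hz, h⟩
    refine ⟨_, hz, ((y - z : (ℝ ∙ u)ᗮ) : V) + (s - s') • u, ?_, ?_⟩
    · rw [mem_closedBall_zero_iff, ← abs_of_nonneg (norm_nonneg _), ← abs_of_nonneg ht,
        ← sq_le_sq, norm_sq_coe_add_smul hu]
      exact h
    · push_cast
      module

theorem le_volume_lineSection_add (hu : ‖u‖ = 1) (hKc : Convex ℝ K) {t : ℝ} (ht : 0 ≤ t)
    {y z w : (ℝ ∙ u)ᗮ} {s s' e e' : ℝ} (hz : (z : V) + s • u ∈ K) (hw : (w : V) + s' • u ∈ K)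
    (he : ‖y - z‖ ^ 2 + e ^ 2 ≤ t ^ 2) (he' : ‖y - w‖ ^ 2 + e' ^ 2 ≤ t ^ 2) :
    ENNReal.ofReal ((s + e) - (s' - e')) ≤
      volume (lineSection u (K + t • closedBall (0 : V) 1) y) := by
  have h1 : s + e ∈ lineSection u (K + t • closedBall (0 : V) 1) y :=
    (coe_add_smul_mem_add_closedBall_iff hu ht).2 ⟨z, s, hz, by simpa using he⟩
  have h2 : s' - e' ∈ lineSection u (K + t • closedBall (0 : V) 1) y :=
    (coe_add_smul_mem_add_closedBall_iff hu ht).2 ⟨w, s', hw, by simpa using he'⟩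
  rw [← Real.volume_Icc]
  exact measure_mono ((convex_lineSection
    (hKc.add ((convex_closedBall _ _).smul t)) y).ordConnected.out h2 h1)

theorem mem_shadow_of_mem_interior {y : (ℝ ∙ u)ᗮ} {s : ℝ} (h : (y : V) + s • u ∈ interior K) :
    y ∈ interior (shadow u K) := by
  rw [mem_interior_iff_mem_nhds] at *
  have : ContinuousAt (fun y : (ℝ ∙ u)ᗮ => (y : V) + s • u) y := by fun_prop
  filter_upwards [this h] with z hz using ⟨s, hz⟩

variable [FiniteDimensional ℝ V] [MeasurableSpace V] [BorelSpace V]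

theorem measurePreserving_smul_add (hu : ‖u‖ = 1) :
    MeasurePreserving fun p : ℝ × (ℝ ∙ u)ᗮ => (p.2 : V) + p.1 • u := by
  have h1 := (LinearIsometryEquiv.toSpanUnitSingleton (𝕜 := ℝ) u hu).measurePreserving.prod
    (MeasurePreserving.id (volume : Measure (ℝ ∙ u)ᗮ))
  have h2 := (ℝ ∙ u).orthogonalDecomposition.symm.measurePreserving.comp
    ((WithLp.volume_preserving_toLp (ℝ ∙ u) (ℝ ∙ u)ᗮ).comp h1)
  convert! h2 using 1
  ext p
  simp [add_comm]

theorem measurable_volume_lineSection {M : Set V} (hM : MeasurableSet M) :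
    Measurable fun y => volume (lineSection u M y) := by
  have : Measurable fun p : ℝ × (ℝ ∙ u)ᗮ => (p.2 : V) + p.1 • u := by fun_prop
  exact measurable_measure_prodMk_right (this hM)

theorem volume_eq_lintegral_lineSection (hu : ‖u‖ = 1) {M : Set V} (hM : MeasurableSet M) :
    volume M = ∫⁻ y, volume (lineSection u M y) := by
  have h := measurePreserving_smul_add hu
  rw [← h.measure_preimage hM.nullMeasurableSet, Measure.volume_eq_prod,
    Measure.prod_apply_symm (h.measurable hM)]
  rfl

end Sections

section SteinerSections

variable {n : ℕ} {u : EuclideanSpace ℝ (Fin n)} {K : Set (EuclideanSpace ℝ (Fin n))}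

theorem eq_of_coe_add_smul_eq {V : Type*} [NormedAddCommGroup V] [InnerProductSpace ℝ V] {u : V}
    (hu : ‖u‖ = 1) {y z : (ℝ ∙ u)ᗮ} {s t : ℝ} (h : (y : V) + s • u = (z : V) + t • u) :
    y = z ∧ s = t := by
  have h0 : ((y - z : (ℝ ∙ u)ᗮ) : V) + (s - t) • u = 0 := by
    push_cast
    rw [sub_smul, sub_add_sub_comm, h, sub_self]
  have h1 := norm_sq_coe_add_smul hu (y - z) (s - t)
  rw [h0, norm_zero] at h1
  have h2 : ‖y - z‖ = 0 := by nlinarith [sq_nonneg (s - t), norm_nonneg (y - z)]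
  have h3 : s - t = 0 := by nlinarith [sq_nonneg (s - t), norm_nonneg (y - z)]
  exact ⟨sub_eq_zero.1 (norm_eq_zero.1 h2), sub_eq_zero.1 h3⟩

theorem mem_lineSection_steinerSymmetral (hu : ‖u‖ = 1) {y : (ℝ ∙ u)ᗮ} {s : ℝ} :
    s ∈ lineSection u (steinerSymmetral u K) y ↔
      y ∈ shadow u K ∧ |s| ≤ (volume (lineSection u K y)).toReal / 2 := by
  constructor
  · rintro ⟨z, t, hz, h, hne, ht⟩
    obtain ⟨rfl, rfl⟩ := eq_of_coe_add_smul_eq hu (z := ⟨z, hz⟩) h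
    exact ⟨hne, ht⟩
  · rintro ⟨hne, ht⟩
    exact ⟨y, s, y.2, rfl, hne, ht⟩

theorem volume_lineSection_steinerSymmetral (hu : ‖u‖ = 1) (hK : IsCompact K) (y : (ℝ ∙ u)ᗮ) :
    volume (lineSection u (steinerSymmetral u K) y) = volume (lineSection u K y) := by
  have hfin : volume (lineSection u K y) ≠ ⊤ := (isCompact_lineSection hu hK y).measure_lt_top.ne
  by_cases hy : y ∈ shadow u K
  · have : lineSection u (steinerSymmetral u K) y =
        Set.Icc (-((volume (lineSection u K y)).toReal / 2))
          ((volume (lineSection u K y)).toReal / 2) := by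
      ext s
      rw [mem_lineSection_steinerSymmetral hu, Set.mem_Icc, abs_le]
      simp [hy]
    rw [this, Real.volume_Icc, sub_neg_eq_add, add_halves, ENNReal.ofReal_toReal hfin]
  · have h1 : lineSection u K y = ∅ := Set.not_nonempty_iff_eq_empty.1 hy
    have h2 : lineSection u (steinerSymmetral u K) y = ∅ := by
      ext s
      simp [mem_lineSection_steinerSymmetral hu, hy]
    rw [h1, h2]

theorem isCompact_steinerSymmetral (hu : ‖u‖ = 1) (hK : IsCompact K) (hKc : Convex ℝ K) :
    IsCompact (steinerSymmetral u K) := by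
  set S : Set (EuclideanSpace ℝ (Fin n) × EuclideanSpace ℝ (Fin n) × ℝ) :=
    (K ×ˢ K ×ˢ Set.Icc (-(1 / 2)) (1 / 2)) ∩ {p | p.1 - p.2.1 ∈ ℝ ∙ u} with hS
  have hSc : IsCompact S := by
    refine (hK.prod (hK.prod isCompact_Icc)).inter_right ?_
    exact (Submodule.closed_of_finiteDimensional (ℝ ∙ u)).preimage (by fun_prop)
  have hcont : Continuous fun p : EuclideanSpace ℝ (Fin n) × EuclideanSpace ℝ (Fin n) × ℝ =>
      p.1 - (inner ℝ u p.1 : ℝ) • u + (p.2.2 * inner ℝ u (p.1 - p.2.1)) • u := by fun_prop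
  convert hSc.image hcont using 1
  have huu : inner ℝ u u = (1 : ℝ) := by rw [real_inner_self_eq_norm_sq, hu, one_pow]
  have hperp : ∀ y : (ℝ ∙ u)ᗮ, inner ℝ u (y : EuclideanSpace ℝ (Fin n)) = (0 : ℝ) := fun y =>
    (Submodule.mem_orthogonal _ _).1 y.2 u (Submodule.mem_span_singleton_self u)
  ext z
  constructor
  · rintro ⟨y, t, hy, rfl, hne, ht⟩
    lift y to (ℝ ∙ u)ᗮ using hy
    have hy' : y ∈ shadow u K := hne
    have hle := sectionBot_le_sectionTop hu hK hy'
    have hvol : (volume {s : ℝ | (y : EuclideanSpace ℝ (Fin n)) + s • u ∈ K}).toReal =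
        sectionTop u K y - sectionBot u K y := by
      rw [← ENNReal.toReal_ofReal (sub_nonneg.2 hle), ← volume_lineSection hu hK hKc hy']
      rfl
    rw [hvol] at ht
    refine ⟨(y + sectionTop u K y • u, y + sectionBot u K y • u,
      t / (sectionTop u K y - sectionBot u K y)), ⟨⟨sectionTop_mem hu hK hy',
        sectionBot_mem hu hK hy', ?_⟩, ?_⟩, ?_⟩
    · rw [Set.mem_Icc, ← abs_le, abs_div, abs_of_nonneg (sub_nonneg.2 hle)]
      exact div_le_of_le_mul₀ (sub_nonneg.2 hle) (by norm_num) (by linarith)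
    · refine Submodule.mem_span_singleton.2 ⟨sectionTop u K y - sectionBot u K y, ?_⟩
      module
    · have e1 : inner ℝ u ((y : EuclideanSpace ℝ (Fin n)) + sectionTop u K y • u) =
          sectionTop u K y := by
        rw [inner_add_right, hperp, real_inner_smul_right, huu]; ring
      have e2 : inner ℝ u ((y : EuclideanSpace ℝ (Fin n)) + sectionBot u K y • u) =
          sectionBot u K y := by
        rw [inner_add_right, hperp, real_inner_smul_right, huu]; ring
      simp only [inner_sub_right, e1, e2]
      have : t / (sectionTop u K y - sectionBot u K y) *
          (sectionTop u K y - sectionBot u K y) = t := by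
        rcases eq_or_ne (sectionTop u K y - sectionBot u K y) 0 with h0 | h0
        · rw [h0] at ht ⊢
          have : |t| = 0 := le_antisymm (by simpa using ht) (abs_nonneg t)
          simp [abs_eq_zero.1 this]
        · field_simp
      rw [this]
      module
  · rintro ⟨⟨x, x', θ⟩, ⟨⟨hx, hx', hθ⟩, hxx⟩, rfl⟩
    simp only at hx hx' hθ
    obtain ⟨a, ha⟩ := Submodule.mem_span_singleton.1 hxx
    simp only at ha
    have hmem : x - (inner ℝ u x : ℝ) • u ∈ (ℝ ∙ u)ᗮ := by
      rw [Submodule.mem_orthogonal_singleton_iff_inner_right, inner_sub_right,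
        real_inner_smul_right, huu]
      ring
    have hin : inner ℝ u (x - x') = a := by rw [← ha, real_inner_smul_right, huu, mul_one]
    refine ⟨_, θ * inner ℝ u (x - x'), hmem, rfl, ⟨inner ℝ u x, by simpa using hx⟩, ?_⟩
    set y : (ℝ ∙ u)ᗮ := ⟨_, hmem⟩
    have h1 : inner ℝ u x ∈ lineSection u K y := by
      change x - (inner ℝ u x : ℝ) • u + (inner ℝ u x : ℝ) • u ∈ K
      simpa using hx
    have h2 : inner ℝ u x - a ∈ lineSection u K y := by
      change x - (inner ℝ u x : ℝ) • u + ((inner ℝ u x : ℝ) - a) • u ∈ K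
      have : x - (inner ℝ u x : ℝ) • u + ((inner ℝ u x : ℝ) - a) • u = x' := by
        rw [sub_smul, ha]; abel
      rwa [this]
    have hsub := (convex_lineSection hKc y).ordConnected.uIcc_subset h1 h2
    have hv := ENNReal.toReal_mono (isCompact_lineSection hu hK y).measure_lt_top.ne
      (measure_mono (μ := volume) hsub)
    rw [Real.volume_interval, ENNReal.toReal_ofReal (abs_nonneg _)] at hv
    have e : |inner ℝ u x - a - inner ℝ u x| = |a| := by
      rw [← abs_neg]; congr 1; ring
    rw [e] at hv
    rw [hin, abs_mul]
    have h3 := abs_le.2 hθ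
    change |θ| * |a| ≤ (volume (lineSection u K y)).toReal / 2
    nlinarith [abs_nonneg a]

theorem volume_steinerSymmetral (hu : ‖u‖ = 1) (hK : IsCompact K) (hKc : Convex ℝ K) :
    volume (steinerSymmetral u K) = volume K := by
  rw [volume_eq_lintegral_lineSection hu (isCompact_steinerSymmetral hu hK hKc).measurableSet,
    volume_eq_lintegral_lineSection hu hK.measurableSet]
  simp_rw [volume_lineSection_steinerSymmetral hu hK]

theorem volume_le_of_forall_ofReal_two_mul_abs_le {S : Set ℝ} {v : ℝ≥0∞}
    (h : ∀ s ∈ S, ENNReal.ofReal (2 * |s|) ≤ v) : volume S ≤ v := by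
  rcases eq_or_ne v ⊤ with rfl | hv
  · exact le_top
  have hsub : S ⊆ Set.Icc (-(v.toReal / 2)) (v.toReal / 2) := by
    intro s hs
    have := (ENNReal.ofReal_le_iff_le_toReal hv).1 (h s hs)
    rw [Set.mem_Icc, ← abs_le]
    linarith
  calc volume S ≤ _ := measure_mono hsub
    _ = v := by rw [Real.volume_Icc, sub_neg_eq_add, add_halves, ENNReal.ofReal_toReal hv]

theorem exists_of_mem_lineSection_steinerSymmetral_add (hu : ‖u‖ = 1) (hK : IsCompact K)
    (hKc : Convex ℝ K) {t : ℝ} (ht : 0 ≤ t) {y : (ℝ ∙ u)ᗮ} {s : ℝ}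
    (hs : s ∈ lineSection u (steinerSymmetral u K +
      t • closedBall (0 : EuclideanSpace ℝ (Fin n)) 1) y) :
    ∃ z ∈ shadow u K, ∃ e : ℝ, ‖y - z‖ ^ 2 + e ^ 2 ≤ t ^ 2 ∧
      2 * |s| ≤ sectionTop u K z - sectionBot u K z + 2 * e := by
  obtain ⟨z, s', hz, h⟩ := (coe_add_smul_mem_add_closedBall_iff hu ht).1 hs
  obtain ⟨hz1, hz2⟩ := (mem_lineSection_steinerSymmetral hu).1 hz
  rw [volume_lineSection hu hK hKc hz1,
    ENNReal.toReal_ofReal (sub_nonneg.2 (sectionBot_le_sectionTop hu hK hz1))] at hz2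
  refine ⟨z, hz1, |s - s'|, by rwa [sq_abs], ?_⟩
  have : |s| ≤ |s'| + |s - s'| := by
    calc |s| = |s' + (s - s')| := by ring_nf
      _ ≤ _ := abs_add_le _ _
  linarith

theorem volume_lineSection_steinerSymmetral_add_le (hu : ‖u‖ = 1) (hK : IsCompact K)
    (hKc : Convex ℝ K) {t : ℝ} (ht : 0 ≤ t) (y : (ℝ ∙ u)ᗮ) :
    volume (lineSection u (steinerSymmetral u K +
        t • closedBall (0 : EuclideanSpace ℝ (Fin n)) 1) y) ≤
      volume (lineSection u (K + t • closedBall (0 : EuclideanSpace ℝ (Fin n)) 1) y) := by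
  refine volume_le_of_forall_ofReal_two_mul_abs_le fun s hs => ?_
  obtain ⟨z, hz, e, he, hse⟩ := exists_of_mem_lineSection_steinerSymmetral_add hu hK hKc ht hs
  refine le_trans (ENNReal.ofReal_le_ofReal ?_) (le_volume_lineSection_add hu hKc ht
    (sectionTop_mem hu hK hz) (sectionBot_mem hu hK hz) he he)
  linarith

theorem volume_lineSection_steinerSymmetral_add_le_ofReal (hu : ‖u‖ = 1) (hK : IsCompact K)
    (hKc : Convex ℝ K) {t : ℝ} (ht : 0 ≤ t) {y x w : (ℝ ∙ u)ᗮ}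
    (hx : ∀ z ∈ shadow u K, sectionTop u K z ≤ sectionTop u K y + inner ℝ x (z - y))
    (hw : ∀ z ∈ shadow u K, sectionBot u K y - inner ℝ w (z - y) ≤ sectionBot u K z) :
    volume (lineSection u (steinerSymmetral u K +
        t • closedBall (0 : EuclideanSpace ℝ (Fin n)) 1) y) ≤
      ENNReal.ofReal (sectionTop u K y - sectionBot u K y + t * √(4 + ‖x + w‖ ^ 2)) := by
  refine volume_le_of_forall_ofReal_two_mul_abs_le fun s hs => ?_
  obtain ⟨z, hz, e, he, hse⟩ := exists_of_mem_lineSection_steinerSymmetral_add hu hK hKc ht hs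
  refine ENNReal.ofReal_le_ofReal ?_
  have h1 := hx z hz
  have h2 := hw z hz
  have h3 : inner ℝ x (z - y) + inner ℝ w (z - y) ≤ ‖x + w‖ * ‖y - z‖ := by
    rw [← inner_add_left, ← norm_sub_rev z y]
    exact real_inner_le_norm _ _
  have h4 : ‖x + w‖ * ‖y - z‖ + 2 * e ≤ t * √(4 + ‖x + w‖ ^ 2) := by
    refine le_of_sq_le_sq ?_ (by positivity)
    rw [mul_pow, Real.sq_sqrt (by positivity)]
    nlinarith [sq_nonneg (‖x + w‖ * e - 2 * ‖y - z‖), sq_nonneg ‖x + w‖]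
  linarith

end SteinerSections

section Gradient

theorem ConcaveOn.le_add_hasFDerivAt {E : Type*} [NormedAddCommGroup E] [NormedSpace ℝ E]
    {s : Set E} {f : E → ℝ} {f' : E →L[ℝ] ℝ} {y z : E} (hf : ConcaveOn ℝ s f) (hy : y ∈ s)
    (hz : z ∈ s) (hd : HasFDerivAt f f' y) : f z ≤ f y + f' (z - y) := by
  have h1 : HasDerivAt (fun t : ℝ => f (y + t • (z - y))) (f' (z - y)) 0 :=
    hd.hasLineDerivAt (z - y)
  have h2 := (hasDerivAt_iff_tendsto_slope_zero.1 h1).mono_left (nhdsGT_le_nhdsNE 0)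
  have h3 : ∀ᶠ t : ℝ in nhdsWithin 0 (Set.Ioi 0), t ∈ Set.Ioc (0 : ℝ) 1 :=
    Ioc_mem_nhdsGT one_pos
  have h4 : f z - f y ≤ f' (z - y) := by
    refine ge_of_tendsto h2 (h3.mono fun t ht => ?_)
    have h5 := hf.2 hy hz (sub_nonneg.2 ht.2) ht.1.le (by ring)
    have e : (1 - t) • y + t • z = y + t • (z - y) := by module
    rw [e] at h5
    simp only [smul_eq_mul, zero_add, zero_smul, add_zero] at h5 ⊢
    rw [le_inv_mul_iff₀ ht.1]
    linarith
  linarith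

theorem norm_smul_sq_add_sq {E : Type*} [NormedAddCommGroup E]
    [InnerProductSpace ℝ E] (t : ℝ) (x : E) :
    ‖t • (√(1 + ‖x‖ ^ 2))⁻¹ • x‖ ^ 2 + (t * (√(1 + ‖x‖ ^ 2))⁻¹) ^ 2 = t ^ 2 := by
  have hpos : 0 < √(1 + ‖x‖ ^ 2) := Real.sqrt_pos.2 (by positivity)
  have hsq := Real.sq_sqrt (show 0 ≤ 1 + ‖x‖ ^ 2 by positivity)
  rw [norm_smul, norm_smul, mul_pow, mul_pow, mul_pow, Real.norm_eq_abs, Real.norm_eq_abs, sq_abs,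
    sq_abs, inv_pow, hsq]
  have : 1 + ‖x‖ ^ 2 ≠ 0 := by positivity
  field_simp
  ring

variable {E : Type*} [NormedAddCommGroup E] [InnerProductSpace ℝ E] [CompleteSpace E]

theorem ConcaveOn.le_add_inner {s : Set E} {f : E → ℝ} {x y z : E} (hf : ConcaveOn ℝ s f)
    (hy : y ∈ s) (hz : z ∈ s) (hd : HasGradientAt f x y) : f z ≤ f y + inner ℝ x (z - y) := by
  simpa using hf.le_add_hasFDerivAt hy hz hd.hasFDerivAt

theorem HasGradientAt.eventually_le_add {f : E → ℝ} {x y : E} (hd : HasGradientAt f x y)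
    {ε : ℝ} (hε : 0 < ε) : ∀ᶠ t : ℝ in nhdsWithin 0 (Set.Ioi 0),
      f y + t * (√(1 + ‖x‖ ^ 2) - ε) ≤
        f (y + t • (√(1 + ‖x‖ ^ 2))⁻¹ • x) + t * (√(1 + ‖x‖ ^ 2))⁻¹ := by
  set v := (√(1 + ‖x‖ ^ 2))⁻¹ • x
  have hpos : 0 < √(1 + ‖x‖ ^ 2) := Real.sqrt_pos.2 (by positivity)
  have h1 : HasDerivAt (fun t : ℝ => f (y + t • v)) (inner ℝ x v) 0 := by
    simpa [HasLineDerivAt] using hd.hasFDerivAt.hasLineDerivAt v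
  have h2 := (hasDerivAt_iff_tendsto_slope_zero.1 h1).mono_left (nhdsGT_le_nhdsNE 0)
  have h3 := h2.eventually (lt_mem_nhds (sub_lt_self (inner ℝ x v) hε))
  filter_upwards [h3, self_mem_nhdsWithin] with t ht ht0
  simp only [smul_eq_mul, zero_add, zero_smul, add_zero] at ht
  have ht' := (lt_inv_mul_iff₀ ht0).1 ht
  have e : (inner ℝ x v : ℝ) = √(1 + ‖x‖ ^ 2) - (√(1 + ‖x‖ ^ 2))⁻¹ := by
    have hsq := Real.sq_sqrt (show 0 ≤ 1 + ‖x‖ ^ 2 by positivity)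
    rw [real_inner_smul_right, real_inner_self_eq_norm_sq]
    field_simp
    linarith
  rw [e] at ht'
  linarith

end Gradient

theorem eventually_ofReal_le_volume_lineSection_add {V : Type*} [NormedAddCommGroup V]
    [InnerProductSpace ℝ V] [FiniteDimensional ℝ V] {u : V} {K : Set V} (hu : ‖u‖ = 1)
    (hK : IsCompact K) (hKc : Convex ℝ K) {x y w : (ℝ ∙ u)ᗮ} (hy : y ∈ interior (shadow u K))
    (hx : HasGradientAt (sectionTop u K) x y)
    (hw : HasGradientAt (fun y => -sectionBot u K y) w y) {ε : ℝ} (hε : 0 < ε) :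
    ∀ᶠ t : ℝ in nhdsWithin 0 (Set.Ioi 0),
      ENNReal.ofReal (sectionTop u K y - sectionBot u K y +
          t * (√(1 + ‖x‖ ^ 2) + √(1 + ‖w‖ ^ 2) - ε)) ≤
        volume (lineSection u (K + t • closedBall (0 : V) 1) y) := by
  have hmem : ∀ v : (ℝ ∙ u)ᗮ, ∀ᶠ t : ℝ in nhdsWithin 0 (Set.Ioi 0), y + t • v ∈ shadow u K := by
    intro v
    have hc : Tendsto (fun t : ℝ => y + t • v) (nhds 0) (nhds y) := by
      have : Continuous fun t : ℝ => y + t • v := by fun_prop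
      simpa using this.tendsto 0
    exact (hc.mono_left nhdsWithin_le_nhds).eventually (mem_interior_iff_mem_nhds.1 hy)
  filter_upwards [hmem ((√(1 + ‖x‖ ^ 2))⁻¹ • x), hmem ((√(1 + ‖w‖ ^ 2))⁻¹ • w),
    hx.eventually_le_add (half_pos hε), hw.eventually_le_add (half_pos hε),
    self_mem_nhdsWithin] with t h1 h2 h3 h4 ht
  refine le_trans (ENNReal.ofReal_le_ofReal ?_) (le_volume_lineSection_add hu hKc (le_of_lt ht)
    (sectionTop_mem hu hK h1) (sectionBot_mem hu hK h2)
    (e := t * (√(1 + ‖x‖ ^ 2))⁻¹) (e' := t * (√(1 + ‖w‖ ^ 2))⁻¹) ?_ ?_)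
  · linarith
  · rw [sub_add_cancel_left, norm_neg, norm_smul_sq_add_sq]
  · rw [sub_add_cancel_left, norm_neg, norm_smul_sq_add_sq]

theorem lintegral_ofReal_le_of_tendsto {α : Type*} [MeasurableSpace α] {μ : Measure α} {Q : Set α}
    {f g : ℝ → α → ℝ≥0∞} (hf : ∀ t, Measurable (f t)) (hg : ∀ t, Measurable (g t))
    (hgt : ∀ t > 0, ∀ a, g t a ≠ ⊤) (hgf : ∀ t > 0, ∀ a, g t a ≤ f t a)
    (hfi : ∀ t > 0, ∫⁻ a, f t a ∂μ ≠ ⊤) {σ : ℝ}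
    (hσ : Tendsto (fun t => ((∫⁻ a, f t a ∂μ).toReal - (∫⁻ a, g t a ∂μ).toReal) / t)
      (nhdsWithin 0 (Set.Ioi 0)) (nhds σ))
    {G : α → ℝ} (hG : ∀ᵐ a ∂(μ.restrict Q), ∀ ε > 0, ∀ᶠ t in nhdsWithin 0 (Set.Ioi 0),
      g t a + ENNReal.ofReal (t * (G a - ε)) ≤ f t a) :
    ∫⁻ a in Q, ENNReal.ofReal (G a) ∂μ ≤ ENNReal.ofReal σ := by
  set φ : ℝ → α → ℝ≥0∞ := fun t a => (f t a - g t a) * (ENNReal.ofReal t)⁻¹ with hφ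
  have hpt : ∀ᵐ a ∂(μ.restrict Q), ENNReal.ofReal (G a) ≤
      liminf (fun t => φ t a) (nhdsWithin 0 (Set.Ioi 0)) := by
    filter_upwards [hG] with a ha
    have hlim : Tendsto (fun ε : ℝ => ENNReal.ofReal (G a - ε)) (nhdsWithin 0 (Set.Ioi 0))
        (nhds (ENNReal.ofReal (G a))) := by
      have : Continuous fun ε : ℝ => ENNReal.ofReal (G a - ε) :=
        ENNReal.continuous_ofReal.comp (by fun_prop)
      simpa using (this.tendsto 0).mono_left (nhdsWithin_le_nhds (s := Set.Ioi (0 : ℝ)))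
    refine le_of_tendsto hlim ?_
    filter_upwards [self_mem_nhdsWithin] with ε hε
    refine le_liminf_of_le (by isBoundedDefault) ?_
    filter_upwards [ha ε hε, self_mem_nhdsWithin] with t ht ht0
    have h1 : ENNReal.ofReal (t * (G a - ε)) ≤ f t a - g t a :=
      ENNReal.le_sub_of_add_le_left (hgt t ht0 a) ht
    rw [hφ]
    simp only
    rw [← div_eq_mul_inv, ENNReal.le_div_iff_mul_le (Or.inl (by simpa using ht0))
      (Or.inl ENNReal.ofReal_ne_top), mul_comm, ← ENNReal.ofReal_mul (le_of_lt ht0)]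
    exact h1
  have hint : ∀ t > 0, ∫⁻ a, φ t a ∂μ =
      ENNReal.ofReal (((∫⁻ a, f t a ∂μ).toReal - (∫⁻ a, g t a ∂μ).toReal) / t) := by
    intro t ht
    have hle := lintegral_mono (μ := μ) (hgf t ht)
    have hgi : ∫⁻ a, g t a ∂μ ≠ ⊤ := ne_top_of_le_ne_top (hfi t ht) hle
    have hm : Measurable fun a => f t a - g t a := (hf t).sub (hg t)
    rw [hφ]
    simp only
    rw [lintegral_mul_const _ hm, lintegral_sub (hg t) hgi
      (Eventually.of_forall (hgf t ht)), ENNReal.ofReal_div_of_pos ht, div_eq_mul_inv,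
      ENNReal.ofReal_sub _ ENNReal.toReal_nonneg, ENNReal.ofReal_toReal hgi,
      ENNReal.ofReal_toReal (hfi t ht)]
  calc ∫⁻ a in Q, ENNReal.ofReal (G a) ∂μ
      ≤ ∫⁻ a in Q, liminf (fun t => φ t a) (nhdsWithin 0 (Set.Ioi 0)) ∂μ := lintegral_mono_ae hpt
    _ ≤ liminf (fun t => ∫⁻ a in Q, φ t a ∂μ) (nhdsWithin 0 (Set.Ioi 0)) :=
        lintegral_liminf_le' fun t => (((hf t).sub (hg t)).mul_const _).aemeasurable
    _ ≤ liminf (fun t => ENNReal.ofReal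
          (((∫⁻ a, f t a ∂μ).toReal - (∫⁻ a, g t a ∂μ).toReal) / t))
          (nhdsWithin 0 (Set.Ioi 0)) := by
        refine liminf_le_liminf ?_
        filter_upwards [self_mem_nhdsWithin] with t ht
        rw [← hint t ht]
        exact setLIntegral_le_lintegral _ _
    _ = ENNReal.ofReal σ := ((ENNReal.continuous_ofReal.tendsto σ).comp hσ).liminf_eq

section SurfaceArea

variable {n : ℕ} {u : EuclideanSpace ℝ (Fin n)} {K : Set (EuclideanSpace ℝ (Fin n))} {S S' : ℝ}

theorem IsCompact.add_smul_closedBall {V : Type*} [NormedAddCommGroup V] [NormedSpace ℝ V]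
    [FiniteDimensional ℝ V] {K : Set V} (hK : IsCompact K) (t : ℝ) :
    IsCompact (K + t • closedBall (0 : V) 1) :=
  hK.add ((isCompact_closedBall _ _).smul t)

theorem volume_lineSection_ne_top {V : Type*} [NormedAddCommGroup V] [InnerProductSpace ℝ V]
    {u : V} {M : Set V} (hu : ‖u‖ = 1) (hM : IsCompact M) (y : (ℝ ∙ u)ᗮ) :
    volume (lineSection u M y) ≠ ⊤ :=
  (isCompact_lineSection hu hM y).measure_lt_top.ne

theorem lintegral_sqrt_gradient_le (hu : ‖u‖ = 1) (hK : IsCompact K) (hKc : Convex ℝ K)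
    (hS : Tendsto (fun t : ℝ =>
        ((volume (K + t • closedBall (0 : EuclideanSpace ℝ (Fin n)) 1)).toReal -
          (volume K).toReal) / t) (nhdsWithin 0 (Set.Ioi 0)) (nhds S))
    {Q : Set (ℝ ∙ u)ᗮ} {x w : (ℝ ∙ u)ᗮ → (ℝ ∙ u)ᗮ}
    (hQ : ∀ᵐ y ∂(volume.restrict Q), y ∈ interior (shadow u K) ∧
      HasGradientAt (sectionTop u K) (x y) y ∧
      HasGradientAt (fun y => -sectionBot u K y) (w y) y) :
    ∫⁻ y in Q, ENNReal.ofReal (√(1 + ‖x y‖ ^ 2) + √(1 + ‖w y‖ ^ 2)) ≤ ENNReal.ofReal S := by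
  have hKt := fun t : ℝ => (hK.add_smul_closedBall t)
  refine lintegral_ofReal_le_of_tendsto
    (f := fun t y => volume (lineSection u (K + t • closedBall 0 1) y))
    (g := fun _ y => volume (lineSection u K y))
    (fun t => measurable_volume_lineSection (hKt t).measurableSet)
    (fun _ => measurable_volume_lineSection hK.measurableSet)
    (fun _ _ y => volume_lineSection_ne_top hu hK y)
    (fun t _ y => measure_mono (lineSection_add_subset t y)) ?_ ?_ ?_
  · intro t _
    rw [← volume_eq_lintegral_lineSection hu (hKt t).measurableSet]
    exact (hKt t).measure_lt_top.ne
  · simpa only [← volume_eq_lintegral_lineSection hu (hKt _).measurableSet,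
      ← volume_eq_lintegral_lineSection hu hK.measurableSet] using hS
  · filter_upwards [hQ] with y ⟨hy, hx, hw⟩ ε hε
    have hys := interior_subset hy
    have hle := sectionBot_le_sectionTop hu hK hys
    filter_upwards [eventually_ofReal_le_volume_lineSection_add hu hK hKc hy hx hw hε,
      self_mem_nhdsWithin] with t ht ht0
    have ht0' : 0 ≤ t := le_of_lt ht0
    rcases le_total 0 (√(1 + ‖x y‖ ^ 2) + √(1 + ‖w y‖ ^ 2) - ε) with h | h
    · rw [volume_lineSection hu hK hKc hys, ← ENNReal.ofReal_add (by linarith) (by positivity)]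
      exact ht
    · rw [ENNReal.ofReal_of_nonpos (mul_nonpos_of_nonneg_of_nonpos ht0' h), add_zero]
      exact measure_mono (lineSection_add_subset t y)

theorem tendsto_volume_sub_volume_div (hu : ‖u‖ = 1) (hK : IsCompact K) (hKc : Convex ℝ K)
    (hS : Tendsto (fun t : ℝ =>
        ((volume (K + t • closedBall (0 : EuclideanSpace ℝ (Fin n)) 1)).toReal -
          (volume K).toReal) / t) (nhdsWithin 0 (Set.Ioi 0)) (nhds S))
    (hS' : Tendsto (fun t : ℝ =>
        ((volume (steinerSymmetral u K + t • closedBall (0 : EuclideanSpace ℝ (Fin n)) 1)).toReal -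
          (volume (steinerSymmetral u K)).toReal) / t) (nhdsWithin 0 (Set.Ioi 0)) (nhds S')) :
    Tendsto (fun t : ℝ => ((volume (K + t • closedBall (0 : EuclideanSpace ℝ (Fin n)) 1)).toReal -
        (volume (steinerSymmetral u K +
          t • closedBall (0 : EuclideanSpace ℝ (Fin n)) 1)).toReal) / t)
      (nhdsWithin 0 (Set.Ioi 0)) (nhds (S - S')) := by
  refine (hS.sub hS').congr fun t => ?_
  rw [volume_steinerSymmetral hu hK hKc]
  ring

theorem volume_steinerSymmetral_add_le (hu : ‖u‖ = 1) (hK : IsCompact K) (hKc : Convex ℝ K)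
    {t : ℝ} (ht : 0 ≤ t) :
    volume (steinerSymmetral u K + t • closedBall (0 : EuclideanSpace ℝ (Fin n)) 1) ≤
      volume (K + t • closedBall (0 : EuclideanSpace ℝ (Fin n)) 1) := by
  rw [volume_eq_lintegral_lineSection hu
      ((isCompact_steinerSymmetral hu hK hKc).add_smul_closedBall t).measurableSet,
    volume_eq_lintegral_lineSection hu (hK.add_smul_closedBall t).measurableSet]
  exact lintegral_mono fun y => volume_lineSection_steinerSymmetral_add_le hu hK hKc ht y

theorem surfaceArea_steinerSymmetral_le (hu : ‖u‖ = 1) (hK : IsCompact K) (hKc : Convex ℝ K)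
    (hS : Tendsto (fun t : ℝ =>
        ((volume (K + t • closedBall (0 : EuclideanSpace ℝ (Fin n)) 1)).toReal -
          (volume K).toReal) / t) (nhdsWithin 0 (Set.Ioi 0)) (nhds S))
    (hS' : Tendsto (fun t : ℝ =>
        ((volume (steinerSymmetral u K + t • closedBall (0 : EuclideanSpace ℝ (Fin n)) 1)).toReal -
          (volume (steinerSymmetral u K)).toReal) / t) (nhdsWithin 0 (Set.Ioi 0)) (nhds S')) :
    S' ≤ S := by
  refine sub_nonneg.1 (ge_of_tendsto (tendsto_volume_sub_volume_div hu hK hKc hS hS') ?_)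
  filter_upwards [self_mem_nhdsWithin] with t ht
  have ht' : 0 ≤ t := le_of_lt ht
  exact div_nonneg (sub_nonneg.2 (ENNReal.toReal_mono
    (hK.add_smul_closedBall t).measure_lt_top.ne (volume_steinerSymmetral_add_le hu hK hKc ht')))
    ht'

theorem lintegral_sqrt_gradient_sub_le (hu : ‖u‖ = 1) (hK : IsCompact K) (hKc : Convex ℝ K)
    (hS : Tendsto (fun t : ℝ =>
        ((volume (K + t • closedBall (0 : EuclideanSpace ℝ (Fin n)) 1)).toReal -
          (volume K).toReal) / t) (nhdsWithin 0 (Set.Ioi 0)) (nhds S))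
    (hS' : Tendsto (fun t : ℝ =>
        ((volume (steinerSymmetral u K + t • closedBall (0 : EuclideanSpace ℝ (Fin n)) 1)).toReal -
          (volume (steinerSymmetral u K)).toReal) / t) (nhdsWithin 0 (Set.Ioi 0)) (nhds S'))
    {Q : Set (ℝ ∙ u)ᗮ} {x w : (ℝ ∙ u)ᗮ → (ℝ ∙ u)ᗮ}
    (hQ : ∀ᵐ y ∂(volume.restrict Q), y ∈ interior (shadow u K) ∧
      HasGradientAt (sectionTop u K) (x y) y ∧
      HasGradientAt (fun y => -sectionBot u K y) (w y) y) :
    ∫⁻ y in Q, ENNReal.ofReal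
        (√(1 + ‖x y‖ ^ 2) + √(1 + ‖w y‖ ^ 2) - √(4 + ‖x y + w y‖ ^ 2)) ≤
      ENNReal.ofReal (S - S') := by
  have hKt := fun t : ℝ => (hK.add_smul_closedBall t)
  have hTt := fun t : ℝ => ((isCompact_steinerSymmetral hu hK hKc).add_smul_closedBall t)
  refine lintegral_ofReal_le_of_tendsto
    (f := fun t y => volume (lineSection u (K + t • closedBall 0 1) y))
    (g := fun t y => volume (lineSection u (steinerSymmetral u K + t • closedBall 0 1) y))
    (fun t => measurable_volume_lineSection (hKt t).measurableSet)
    (fun t => measurable_volume_lineSection (hTt t).measurableSet)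
    (fun t _ y => volume_lineSection_ne_top hu (hTt t) y)
    (fun t ht y => volume_lineSection_steinerSymmetral_add_le hu hK hKc (le_of_lt ht) y) ?_ ?_ ?_
  · intro t _
    rw [← volume_eq_lintegral_lineSection hu (hKt t).measurableSet]
    exact (hKt t).measure_lt_top.ne
  · simpa only [← volume_eq_lintegral_lineSection hu (hKt _).measurableSet,
      ← volume_eq_lintegral_lineSection hu (hTt _).measurableSet] using
      tendsto_volume_sub_volume_div hu hK hKc hS hS'
  · filter_upwards [hQ] with y ⟨hy, hx, hw⟩ ε hε
    have hys := interior_subset hy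
    have hle := sectionBot_le_sectionTop hu hK hys
    filter_upwards [eventually_ofReal_le_volume_lineSection_add hu hK hKc hy hx hw hε,
      self_mem_nhdsWithin] with t ht ht0
    have ht0' : 0 ≤ t := le_of_lt ht0
    rcases le_total 0
      (√(1 + ‖x y‖ ^ 2) + √(1 + ‖w y‖ ^ 2) - √(4 + ‖x y + w y‖ ^ 2) - ε) with h | h
    · have h1 := volume_lineSection_steinerSymmetral_add_le_ofReal (w := w y) hu hK hKc ht0'
        (fun z hz => (concaveOn_sectionTop hu hK hKc).le_add_inner hys hz hx)
        (fun z hz => by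
          have := (convexOn_sectionBot hu hK hKc).neg.le_add_inner hys hz hw
          simp only [Pi.neg_apply] at this
          linarith)
      refine (add_le_add_left h1 _).trans ?_
      have h2 : 0 ≤ t * √(4 + ‖x y + w y‖ ^ 2) := by positivity
      rw [← ENNReal.ofReal_add (by linarith) (by positivity)]
      refine le_trans (ENNReal.ofReal_le_ofReal (le_of_eq ?_)) ht
      ring
    · rw [ENNReal.ofReal_of_nonpos (mul_nonpos_of_nonneg_of_nonpos ht0' h), add_zero]
      exact volume_lineSection_steinerSymmetral_add_le hu hK hKc ht0' y

theorem surfaceArea_nonneg (hK : IsCompact K)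
    (hS : Tendsto (fun t : ℝ =>
        ((volume (K + t • closedBall (0 : EuclideanSpace ℝ (Fin n)) 1)).toReal -
          (volume K).toReal) / t) (nhdsWithin 0 (Set.Ioi 0)) (nhds S)) : 0 ≤ S := by
  refine ge_of_tendsto hS ?_
  filter_upwards [self_mem_nhdsWithin] with t ht
  refine div_nonneg (sub_nonneg.2 (ENNReal.toReal_mono
    (hK.add_smul_closedBall t).measure_lt_top.ne (measure_mono fun k hk => ?_))) (le_of_lt ht)
  exact ⟨k, hk, 0, ⟨0, by simp, by simp⟩, add_zero k⟩

theorem surfaceArea_le (hK : IsCompact K) (hKc : Convex ℝ K) {r : ℝ} (hr : 0 < r)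
    (hrK : r • closedBall (0 : EuclideanSpace ℝ (Fin n)) 1 ⊆ K)
    (hS : Tendsto (fun t : ℝ =>
        ((volume (K + t • closedBall (0 : EuclideanSpace ℝ (Fin n)) 1)).toReal -
          (volume K).toReal) / t) (nhdsWithin 0 (Set.Ioi 0)) (nhds S)) :
    S ≤ n / r * (volume K).toReal := by
  have hd : HasDerivAt (fun t : ℝ => (1 + t / r) ^ n * (volume K).toReal)
      (n / r * (volume K).toReal) 0 := by
    have h1 : HasDerivAt (fun t : ℝ => 1 + t / r) (1 / r) 0 :=
      ((hasDerivAt_id 0).div_const r).const_add 1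
    refine ((h1.fun_pow n).mul_const (volume K).toReal).congr_deriv ?_
    simp [div_eq_mul_inv]
  have hlim := (hasDerivAt_iff_tendsto_slope_zero.1 hd).mono_left (nhdsGT_le_nhdsNE 0)
  refine le_of_tendsto_of_tendsto hS hlim ?_
  filter_upwards [self_mem_nhdsWithin] with t ht
  have ht0 : 0 < t := ht
  have hsub : K + t • closedBall (0 : EuclideanSpace ℝ (Fin n)) 1 ⊆ (1 + t / r) • K := by
    rw [hKc.add_smul zero_le_one (by positivity), one_smul]
    refine Set.add_subset_add_left ?_
    have : t • closedBall (0 : EuclideanSpace ℝ (Fin n)) 1 =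
        (t / r) • r • closedBall (0 : EuclideanSpace ℝ (Fin n)) 1 := by
      rw [smul_smul, div_mul_cancel₀ _ hr.ne']
    rw [this]
    exact Set.smul_set_mono hrK
  have hv : (volume (K + t • closedBall (0 : EuclideanSpace ℝ (Fin n)) 1)).toReal ≤
      (1 + t / r) ^ n * (volume K).toReal := by
    have h1 := measure_mono (μ := volume) hsub
    rw [Measure.addHaar_smul, finrank_euclideanSpace_fin] at h1
    have h2 := ENNReal.toReal_mono
      (ENNReal.mul_ne_top ENNReal.ofReal_ne_top hK.measure_lt_top.ne) h1
    rwa [ENNReal.toReal_mul, ENNReal.toReal_ofReal (abs_nonneg _),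
      abs_of_nonneg (by positivity)] at h2
  simp only [zero_add, zero_div, add_zero, one_pow, one_mul, smul_eq_mul]
  rw [div_eq_inv_mul]
  gcongr

end SurfaceArea

theorem norm_sub_sq_le_sqrt_sub_mul {E : Type*} [NormedAddCommGroup E] [InnerProductSpace ℝ E]
    (x w : E) :
    0 ≤ √(1 + ‖x‖ ^ 2) + √(1 + ‖w‖ ^ 2) - √(4 + ‖x + w‖ ^ 2) ∧
    ‖x - w‖ ^ 2 ≤ (√(1 + ‖x‖ ^ 2) + √(1 + ‖w‖ ^ 2) - √(4 + ‖x + w‖ ^ 2)) *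
      (√(1 + ‖x‖ ^ 2) + √(1 + ‖w‖ ^ 2)) * ((√(1 + ‖x‖ ^ 2) + √(1 + ‖w‖ ^ 2)) ^ 2 / 2) := by
  have ha := Real.sq_sqrt (show 0 ≤ 1 + ‖x‖ ^ 2 by positivity)
  have hb := Real.sq_sqrt (show 0 ≤ 1 + ‖w‖ ^ 2 by positivity)
  have hc := Real.sq_sqrt (show 0 ≤ 4 + ‖x + w‖ ^ 2 by positivity)
  have ha0 := Real.sqrt_nonneg (1 + ‖x‖ ^ 2)
  have hb0 := Real.sqrt_nonneg (1 + ‖w‖ ^ 2)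
  have hadd : ‖x + w‖ ^ 2 = ‖x‖ ^ 2 + 2 * inner ℝ x w + ‖w‖ ^ 2 := norm_add_sq_real x w
  have hsub : ‖x - w‖ ^ 2 = ‖x‖ ^ 2 - 2 * inner ℝ x w + ‖w‖ ^ 2 := norm_sub_sq_real x w
  have hp2 : inner ℝ x w ^ 2 ≤ ‖x‖ ^ 2 * ‖w‖ ^ 2 := by
    rw [← mul_pow, ← sq_abs]
    exact pow_le_pow_left₀ (abs_nonneg _) (abs_real_inner_le_norm x w) 2
  have hd0 := sq_nonneg ‖x - w‖
  generalize √(1 + ‖x‖ ^ 2) = a at *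
  generalize √(1 + ‖w‖ ^ 2) = b at *
  generalize √(4 + ‖x + w‖ ^ 2) = c at *
  generalize inner ℝ x w = p at *
  have hab2 : (a * b) ^ 2 = (1 + ‖x‖ ^ 2) * (1 + ‖w‖ ^ 2) := by rw [mul_pow, ha, hb]
  have h0 : ‖x - w‖ ^ 2 ≤ (a * b) ^ 2 - (1 + p) ^ 2 := by
    rw [hab2, hsub]
    linarith
  obtain ⟨h1', h1⟩ : -(a * b) ≤ 1 + p ∧ 1 + p ≤ a * b :=
    abs_le.1 (abs_le_of_sq_le_sq (by linarith) (mul_nonneg ha0 hb0))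
  have h2 : (a + b) ^ 2 - c ^ 2 = 2 * (a * b - (1 + p)) := by
    rw [hc, hadd, add_sq, ha, hb]; ring
  have hcW : c ≤ a + b :=
    le_trans (le_abs_self _) (abs_le_of_sq_le_sq (by linarith) (add_nonneg ha0 hb0))
  refine ⟨sub_nonneg.2 hcW, ?_⟩
  have h3 : a * b - (1 + p) ≤ (a + b - c) * (a + b) := by
    have := mul_le_mul_of_nonneg_left (show a + b + c ≤ 2 * (a + b) by linarith)
      (sub_nonneg.2 hcW)
    linarith
  calc ‖x - w‖ ^ 2 ≤ (a * b - (1 + p)) * (a * b + (1 + p)) := by linarith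
    _ ≤ _ := mul_le_mul h3 (by linarith [sq_nonneg (a - b)]) (by linarith)
      (mul_nonneg (sub_nonneg.2 hcW) (add_nonneg ha0 hb0))

theorem norm_sub_div_two_le {E : Type*} [NormedAddCommGroup E] [InnerProductSpace ℝ E] {x w : E}
    {L τ : ℝ} (hL : 1 ≤ L) (hx : ‖x‖ ≤ L) (hw : ‖w‖ ≤ L) (hτ : 0 < τ) :
    ‖x - w‖ / 2 ≤ L / 2 * τ * (√(1 + ‖x‖ ^ 2) + √(1 + ‖w‖ ^ 2) - √(4 + ‖x + w‖ ^ 2)) +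
      L / (2 * τ) * (√(1 + ‖x‖ ^ 2) + √(1 + ‖w‖ ^ 2)) := by
  obtain ⟨hD0, h4⟩ := norm_sub_sq_le_sqrt_sub_mul x w
  have hW0 : 0 ≤ √(1 + ‖x‖ ^ 2) + √(1 + ‖w‖ ^ 2) := by positivity
  have h5 : (√(1 + ‖x‖ ^ 2) + √(1 + ‖w‖ ^ 2)) ^ 2 ≤ 8 * L ^ 2 := by
    have ha := Real.sq_sqrt (show 0 ≤ 1 + ‖x‖ ^ 2 by positivity)
    have hb := Real.sq_sqrt (show 0 ≤ 1 + ‖w‖ ^ 2 by positivity)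
    have hx2 : ‖x‖ ^ 2 ≤ L ^ 2 := pow_le_pow_left₀ (norm_nonneg _) hx 2
    have hw2 : ‖w‖ ^ 2 ≤ L ^ 2 := pow_le_pow_left₀ (norm_nonneg _) hw 2
    have hL2 : 1 ≤ L ^ 2 := one_le_pow₀ hL
    linarith [sq_nonneg (√(1 + ‖x‖ ^ 2) - √(1 + ‖w‖ ^ 2))]
  generalize √(1 + ‖x‖ ^ 2) + √(1 + ‖w‖ ^ 2) = W at *
  generalize W - √(4 + ‖x + w‖ ^ 2) = D at *
  have h6 : ‖x - w‖ ^ 2 ≤ 4 * L ^ 2 * (D * W) := by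
    have := mul_le_mul_of_nonneg_left h5 (mul_nonneg hD0 hW0)
    linarith
  have h7 : L / 2 * τ * D + L / (2 * τ) * W = L / 2 * (τ * D + W / τ) := by
    field_simp
  rw [h7]
  refine le_trans (le_abs_self _) (abs_le_of_sq_le_sq ?_ (by positivity))
  have h8 : (τ * D) * (W / τ) = D * W := by field_simp
  have h9 : 4 * (D * W) ≤ (τ * D + W / τ) ^ 2 := by
    linarith [sq_nonneg (τ * D - W / τ)]
  have h10 := mul_le_mul_of_nonneg_left h9 (sq_nonneg L)
  rw [div_pow, mul_pow, div_pow]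
  linarith

theorem ConcaveOn.lipschitzOnWith_of_closedBall_subset {E : Type*} [NormedAddCommGroup E]
    [NormedSpace ℝ E] {P Q : Set E} {f : E → ℝ} {R ρ : ℝ} (hf : ConcaveOn ℝ P f)
    (hR : ∀ y ∈ P, |f y| ≤ R) (hρ : 0 < ρ) (hQ : ∀ y ∈ Q, closedBall y ρ ⊆ P) :
    LipschitzOnWith (2 * R / ρ).toNNReal f Q := by
  refine LipschitzOnWith.of_le_add_mul _ fun y' hy' y hy => ?_
  have hy'P := hQ y' hy' (mem_closedBall_self hρ.le)
  have hR0 : 0 ≤ R := (abs_nonneg _).trans (hR _ hy'P)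
  rw [Real.coe_toNNReal _ (by positivity)]
  rcases eq_or_ne y' y with rfl | hne
  · simp
  set δ := dist y' y with hδ
  have hδ0 : 0 < δ := dist_pos.2 hne
  set z := y + (ρ / δ) • (y - y') with hz
  have hzP : z ∈ P := by
    refine hQ y hy ?_
    rw [mem_closedBall, hz, dist_self_add_left, norm_smul, Real.norm_of_nonneg (by positivity),
      ← dist_eq_norm, dist_comm y y', ← hδ, div_mul_cancel₀ _ hδ0.ne']
  have h1 := hf.2 hy'P hzP (show 0 ≤ ρ / (ρ + δ) by positivity)
    (show 0 ≤ δ / (ρ + δ) by positivity) (by field_simp)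
  have e : (ρ / (ρ + δ)) • y' + (δ / (ρ + δ)) • z = y := by
    have h2 : (δ / (ρ + δ)) * (ρ / δ) = ρ / (ρ + δ) := by field_simp
    have h3 : y = (ρ / (ρ + δ) + δ / (ρ + δ)) • y := by
      rw [← add_div, div_self (by positivity), one_smul]
    rw [hz, smul_add, smul_smul, h2]
    nth_rewrite 3 [h3]
    module
  rw [e, smul_eq_mul, smul_eq_mul] at h1
  have h4 : ρ * f y' + δ * f z ≤ (ρ + δ) * f y := by
    have : ρ / (ρ + δ) * f y' + δ / (ρ + δ) * f z = (ρ * f y' + δ * f z) / (ρ + δ) := by ring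
    rw [this, div_le_iff₀ (by positivity)] at h1
    linarith
  have h5 := abs_le.1 (hR z hzP)
  have h6 := abs_le.1 (hR y (hQ y hy (mem_closedBall_self hρ.le)))
  have h7 : 2 * R / ρ * δ = (2 * R * δ) / ρ := by ring
  rw [h7, ← sub_le_iff_le_add', le_div_iff₀ hρ]
  nlinarith

theorem LipschitzOnWith.ae_hasGradientAt {E : Type*} [NormedAddCommGroup E]
    [InnerProductSpace ℝ E] [FiniteDimensional ℝ E] [MeasurableSpace E] [BorelSpace E]
    {f : E → ℝ} {Q : Set E} {L : ℝ≥0} (hf : LipschitzOnWith L f Q) (hQ : IsOpen Q) :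
    ∀ᵐ y ∂(volume.restrict Q), HasGradientAt f (gradient f y) y ∧ ‖gradient f y‖ ≤ L := by
  filter_upwards [hf.ae_differentiableWithinAt hQ.measurableSet,
    ae_restrict_mem hQ.measurableSet] with y hy hyQ
  have h := (hy.differentiableAt (hQ.mem_nhds hyQ)).hasGradientAt
  refine ⟨h, ?_⟩
  have := h.hasFDerivAt.le_of_lipschitzOn (hQ.mem_nhds hyQ) hf
  rwa [LinearIsometryEquiv.norm_map] at this

theorem abs_le_norm_coe_add_smul {V : Type*} [NormedAddCommGroup V] [InnerProductSpace ℝ V]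
    {u : V} (hu : ‖u‖ = 1) (y : (ℝ ∙ u)ᗮ) (s : ℝ) : |s| ≤ ‖(y : V) + s • u‖ := by
  refine abs_le_of_sq_le_sq ?_ (norm_nonneg _)
  rw [norm_sq_coe_add_smul hu]
  linarith [sq_nonneg ‖y‖]

theorem norm_le_norm_coe_add_smul {V : Type*} [NormedAddCommGroup V] [InnerProductSpace ℝ V]
    {u : V} (hu : ‖u‖ = 1) (y : (ℝ ∙ u)ᗮ) (s : ℝ) : ‖y‖ ≤ ‖(y : V) + s • u‖ := by
  refine le_trans (le_abs_self _) (abs_le_of_sq_le_sq ?_ (norm_nonneg _))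
  rw [norm_sq_coe_add_smul hu]
  linarith [sq_nonneg s]

section ShrunkShadow

variable {V : Type*} [NormedAddCommGroup V] [InnerProductSpace ℝ V] {u : V} {K : Set V}
  {r R ε : ℝ}

theorem closedBall_subset_shadow (hr : 0 < r) (hrK : r • closedBall (0 : V) 1 ⊆ K) :
    closedBall (0 : (ℝ ∙ u)ᗮ) r ⊆ shadow u K := by
  intro y hy
  refine ⟨0, ?_⟩
  change (y : V) + (0 : ℝ) • u ∈ K
  refine hrK ?_
  rw [smul_unitClosedBall, Real.norm_of_nonneg hr.le, zero_smul, add_zero]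
  simpa using hy

theorem closedBall_subset_of_mem_smul_interior {E : Type*} [NormedAddCommGroup E]
    [NormedSpace ℝ E] {P : Set E} (hP : Convex ℝ P) (hrP : closedBall 0 r ⊆ P) (hε : 0 < ε)
    (hε1 : ε < 1) {y : E} (hy : y ∈ (1 - ε) • interior P) : closedBall y (ε * r) ⊆ P := by
  obtain ⟨p, hp, rfl⟩ := hy
  intro z hz
  have h1 : ε⁻¹ • (z - (1 - ε) • p) ∈ P := by
    refine hrP ?_
    rw [mem_closedBall_zero_iff, norm_smul, norm_inv, Real.norm_of_nonneg hε.le,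
      inv_mul_le_iff₀ hε, ← dist_eq_norm]
    exact hz
  have h2 := hP (interior_subset hp) h1 (sub_nonneg.2 hε1.le) hε.le (by ring)
  rwa [smul_inv_smul₀ hε.ne', add_sub_cancel] at h2

theorem exists_lintegral_abs_midpoint_sub_le {n : ℕ} {u : EuclideanSpace ℝ (Fin n)}
    {K : Set (EuclideanSpace ℝ (Fin n))} {S S' : ℝ} (hu : ‖u‖ = 1) (hK : IsCompact K)
    (hKc : Convex ℝ K) (hr : 0 < r) (hrR : r ≤ R)
    (hrK : r • closedBall (0 : EuclideanSpace ℝ (Fin n)) 1 ⊆ K)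
    (hKR : K ⊆ R • closedBall (0 : EuclideanSpace ℝ (Fin n)) 1)
    (hS : Tendsto (fun t : ℝ =>
        ((volume (K + t • closedBall (0 : EuclideanSpace ℝ (Fin n)) 1)).toReal -
          (volume K).toReal) / t) (nhdsWithin 0 (Set.Ioi 0)) (nhds S))
    (hS' : Tendsto (fun t : ℝ =>
        ((volume (steinerSymmetral u K + t • closedBall (0 : EuclideanSpace ℝ (Fin n)) 1)).toReal -
          (volume (steinerSymmetral u K)).toReal) / t) (nhdsWithin 0 (Set.Ioi 0)) (nhds S'))
    (hε : 0 < ε) (hε1 : ε < 1) {τ : ℝ} (hτ : 0 < τ) :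
    ∃ c : ℝ, ∫⁻ y in (1 - ε) • interior (shadow u K),
        ENNReal.ofReal |(sectionTop u K y + sectionBot u K y) / 2 - c| ≤
      ENNReal.ofReal (8 * R * (R / (ε * r) * τ * (S - S') + R / (ε * r) / τ * S)) := by
  set P := shadow u K
  set Q := (1 - ε) • interior P
  set L := 2 * R / (ε * r) with hL
  have hR : 0 < R := hr.trans_le hrR
  have hεr : 0 < ε * r := mul_pos hε hr
  have hL1 : 1 ≤ L := by
    rw [hL, one_le_div hεr]
    nlinarith
  have hL0 : 0 ≤ L := by linarith
  have hKR' : ∀ x ∈ K, ‖x‖ ≤ R := by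
    intro x hx
    have := hKR hx
    rwa [smul_unitClosedBall, Real.norm_of_nonneg hR.le, mem_closedBall_zero_iff] at this
  have hPc : Convex ℝ P := (concaveOn_sectionTop hu hK hKc).1
  have hball : ∀ y ∈ Q, closedBall y (ε * r) ⊆ P := fun y hy =>
    closedBall_subset_of_mem_smul_interior hPc (closedBall_subset_shadow hr hrK) hε hε1 hy
  have hQo : IsOpen Q := isOpen_interior.smul₀ (by linarith)
  have hQc : Convex ℝ Q := hPc.interior.smul _
  have hQP : Q ⊆ interior P := fun y hy =>
    mem_interior.2 ⟨ball y (ε * r), ball_subset_closedBall.trans (hball y hy), isOpen_ball,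
      mem_ball_self hεr⟩
  have hdiam : ∀ x ∈ Q, ∀ y ∈ Q, ‖x - y‖ ≤ 2 * R := by
    have : ∀ x ∈ Q, ‖x‖ ≤ R := fun x hx =>
      (norm_le_norm_coe_add_smul hu x _).trans
        (hKR' _ (sectionTop_mem hu hK (interior_subset (hQP hx))))
    intro x hx y hy
    linarith [norm_sub_le x y, this x hx, this y hy]
  have htop : LipschitzOnWith L.toNNReal (sectionTop u K) Q :=
    (concaveOn_sectionTop hu hK hKc).lipschitzOnWith_of_closedBall_subset
      (fun y hy => (abs_le_norm_coe_add_smul hu y _).trans (hKR' _ (sectionTop_mem hu hK hy)))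
      hεr hball
  have hbot : LipschitzOnWith L.toNNReal (fun y => -sectionBot u K y) Q :=
    (convexOn_sectionBot hu hK hKc).neg.lipschitzOnWith_of_closedBall_subset
      (fun y hy => by
        rw [Pi.neg_apply, abs_neg]
        exact (abs_le_norm_coe_add_smul hu y _).trans (hKR' _ (sectionBot_mem hu hK hy)))
      hεr hball
  set x := gradient (sectionTop u K)
  set w := gradient (fun y => -sectionBot u K y)
  set d := fun y => (sectionTop u K y + sectionBot u K y) / 2 with hd
  have hdL : LipschitzOnWith L.toNNReal d Q := by
    refine LipschitzOnWith.of_le_add_mul _ fun a ha b hb => ?_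
    have h1 := (abs_le.1 (htop.dist_le_mul a ha b hb)).2
    have h2 := (abs_le.1 (hbot.dist_le_mul b hb a ha)).2
    rw [dist_comm b a] at h2
    simp only [hd]
    linarith
  have hgrad : ∀ᵐ y ∂(volume.restrict Q), y ∈ interior P ∧
      HasGradientAt (sectionTop u K) (x y) y ∧
      HasGradientAt (fun y => -sectionBot u K y) (w y) y ∧ ‖x y‖ ≤ L ∧ ‖w y‖ ≤ L := by
    filter_upwards [htop.ae_hasGradientAt hQo, hbot.ae_hasGradientAt hQo,
      ae_restrict_mem hQo.measurableSet] with y h1 h2 hy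
    rw [Real.coe_toNNReal _ hL0] at h1 h2
    exact ⟨hQP hy, h1.1, h2.1, h1.2, h2.2⟩
  have hgrad' := hgrad.mono fun y h => (⟨h.1, h.2.1, h.2.2.1⟩ :
    y ∈ interior P ∧ HasGradientAt (sectionTop u K) (x y) y ∧
      HasGradientAt (fun y => -sectionBot u K y) (w y) y)
  have hW := lintegral_sqrt_gradient_le hu hK hKc hS hgrad'
  have hD := lintegral_sqrt_gradient_sub_le hu hK hKc hS hS' hgrad'
  have hS0 := surfaceArea_nonneg hK hS
  have hSS := sub_nonneg.2 (surfaceArea_steinerSymmetral_le hu hK hKc hS hS')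
  obtain ⟨c, hc⟩ := exists_lintegral_abs_sub_le_lintegral_fderiv hQo hQc hdiam hdL
  refine ⟨c, hc.trans ?_⟩
  have hmeas : Measurable fun y => ENNReal.ofReal (√(1 + ‖x y‖ ^ 2) + √(1 + ‖w y‖ ^ 2)) := by
    have hx : Measurable fun y => ‖x y‖ := by
      have : ∀ y, ‖x y‖ = ‖fderiv ℝ (sectionTop u K) y‖ := fun y =>
        LinearIsometryEquiv.norm_map _ _
      simp_rw [this]
      exact (measurable_fderiv ℝ _).norm
    have hw : Measurable fun y => ‖w y‖ := by
      have : ∀ y, ‖w y‖ = ‖fderiv ℝ (fun y => -sectionBot u K y) y‖ := fun y =>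
        LinearIsometryEquiv.norm_map _ _
      simp_rw [this]
      exact (measurable_fderiv ℝ _).norm
    fun_prop
  have hfd : ∫⁻ y in Q, ‖fderiv ℝ d y‖ₑ ≤
      ENNReal.ofReal (L / 2 * τ * (S - S') + L / (2 * τ) * S) := by
    calc ∫⁻ y in Q, ‖fderiv ℝ d y‖ₑ
        ≤ ∫⁻ y in Q, (ENNReal.ofReal (L / 2 * τ) * ENNReal.ofReal
              (√(1 + ‖x y‖ ^ 2) + √(1 + ‖w y‖ ^ 2) - √(4 + ‖x y + w y‖ ^ 2)) +
            ENNReal.ofReal (L / (2 * τ)) *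
              ENNReal.ofReal (√(1 + ‖x y‖ ^ 2) + √(1 + ‖w y‖ ^ 2))) := by
          refine lintegral_mono_ae ?_
          filter_upwards [hgrad] with y ⟨_, h1, h2, h3, h4⟩
          have hder : HasFDerivAt d (InnerProductSpace.toDual ℝ _ ((2 : ℝ)⁻¹ • (x y - w y))) y := by
            have := (h1.hasFDerivAt.sub h2.hasFDerivAt).const_smul (2 : ℝ)⁻¹
            rw [← map_sub, ← map_smul] at this
            refine this.congr_of_eventuallyEq (Eventually.of_forall fun z => ?_)
            simp [hd]
            ring
          rw [hder.fderiv, ← ofReal_norm, LinearIsometryEquiv.norm_map, norm_smul,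
            norm_inv, Real.norm_ofNat, ← ENNReal.ofReal_mul (by positivity),
            ← ENNReal.ofReal_mul (by positivity), ← ENNReal.ofReal_add
              (mul_nonneg (by positivity) (norm_sub_sq_le_sqrt_sub_mul (x y) (w y)).1)
              (by positivity)]
          refine ENNReal.ofReal_le_ofReal ?_
          rw [inv_mul_eq_div]
          exact norm_sub_div_two_le hL1 h3 h4 hτ
      _ = ENNReal.ofReal (L / 2 * τ) * (∫⁻ y in Q, ENNReal.ofReal
              (√(1 + ‖x y‖ ^ 2) + √(1 + ‖w y‖ ^ 2) - √(4 + ‖x y + w y‖ ^ 2))) +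
            ENNReal.ofReal (L / (2 * τ)) * ∫⁻ y in Q,
              ENNReal.ofReal (√(1 + ‖x y‖ ^ 2) + √(1 + ‖w y‖ ^ 2)) := by
          rw [lintegral_add_right _ (hmeas.const_mul _),
            lintegral_const_mul' _ _ ENNReal.ofReal_ne_top,
            lintegral_const_mul' _ _ ENNReal.ofReal_ne_top]
      _ ≤ ENNReal.ofReal (L / 2 * τ) * ENNReal.ofReal (S - S') +
            ENNReal.ofReal (L / (2 * τ)) * ENNReal.ofReal S := by gcongr
      _ = _ := by
          rw [← ENNReal.ofReal_mul (by positivity), ← ENNReal.ofReal_mul (by positivity),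
            ← ENNReal.ofReal_add (by positivity) (by positivity)]
  refine (mul_le_mul_right hfd _).trans (le_of_eq ?_)
  rw [← ENNReal.ofReal_mul (by positivity)]
  congr 1
  rw [hL]
  field_simp
  ring

end ShrunkShadow

section SymmetricDifference

theorem volume_symmDiff_Icc_le (a b v : ℝ) :
    volume (symmDiff (Set.Icc a b) (Set.Icc (a + v) (b + v))) ≤ 2 * ENNReal.ofReal |v| := by
  have key : ∀ a b v : ℝ, volume (Set.Icc a b \ Set.Icc (a + v) (b + v)) ≤
      ENNReal.ofReal |v| := by
    intro a b v
    rcases le_total 0 v with hv | hv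
    · calc volume (Set.Icc a b \ Set.Icc (a + v) (b + v)) ≤ volume (Set.Ico a (a + v)) :=
          measure_mono fun s hs => ⟨hs.1.1, by
            by_contra! h
            exact hs.2 ⟨h, by linarith [hs.1.2]⟩⟩
        _ = ENNReal.ofReal |v| := by rw [Real.volume_Ico, add_sub_cancel_left, abs_of_nonneg hv]
    · calc volume (Set.Icc a b \ Set.Icc (a + v) (b + v)) ≤ volume (Set.Ioc (b + v) b) :=
          measure_mono fun s hs => ⟨by
            by_contra! h
            exact hs.2 ⟨by linarith [hs.1.1], h⟩, hs.1.2⟩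
        _ = ENNReal.ofReal |v| := by
          rw [Real.volume_Ioc, abs_of_nonpos hv]
          congr 1
          ring
  have h1 := key a b v
  have h2 := key (a + v) (b + v) (-v)
  rw [add_neg_cancel_right, add_neg_cancel_right, abs_neg] at h2
  calc _ ≤ _ := measure_union_le _ _
    _ ≤ ENNReal.ofReal |v| + ENNReal.ofReal |v| := add_le_add h1 h2
    _ = _ := (two_mul _).symm

theorem volume_symmDiff_le {α : Type*} [MeasurableSpace α] (μ : Measure α) (s t : Set α) :
    μ (symmDiff s t) ≤ μ s + μ t :=
  (measure_union_le _ _).trans (add_le_add (measure_mono Set.sdiff_subset)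
    (measure_mono Set.sdiff_subset))

variable {n : ℕ} {u : EuclideanSpace ℝ (Fin n)} {K : Set (EuclideanSpace ℝ (Fin n))} {r R ε : ℝ}

theorem lineSection_vadd {V : Type*} [NormedAddCommGroup V] [InnerProductSpace ℝ V] (u : V)
    (M : Set V) (c : ℝ) (y : (ℝ ∙ u)ᗮ) :
    lineSection u ((c • u) +ᵥ M) y = c +ᵥ lineSection u M y := by
  ext s
  rw [Set.mem_vadd_set_iff_neg_vadd_mem]
  change (y : V) + s • u ∈ (c • u) +ᵥ M ↔ (y : V) + (-c + s) • u ∈ M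
  rw [Set.mem_vadd_set_iff_neg_vadd_mem, vadd_eq_add, add_smul, neg_smul]
  rw [show -(c • u) + ((y : V) + s • u) = (y : V) + (-(c • u) + s • u) by abel]

theorem volume_lineSection_symmDiff_le (hu : ‖u‖ = 1) (hK : IsCompact K) (c : ℝ) (y : (ℝ ∙ u)ᗮ) :
    volume (lineSection u (symmDiff K ((c • u) +ᵥ steinerSymmetral u K)) y) ≤
      2 * volume (lineSection u K y) := by
  change volume (symmDiff (lineSection u K y)
    (lineSection u ((c • u) +ᵥ steinerSymmetral u K) y)) ≤ _
  refine (volume_symmDiff_le _ _ _).trans (le_of_eq ?_)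
  rw [lineSection_vadd, measure_vadd, volume_lineSection_steinerSymmetral hu hK, two_mul]

theorem volume_lineSection_symmDiff_le_abs (hu : ‖u‖ = 1) (hK : IsCompact K) (hKc : Convex ℝ K)
    (c : ℝ) {y : (ℝ ∙ u)ᗮ} (hy : y ∈ shadow u K) :
    volume (lineSection u (symmDiff K ((c • u) +ᵥ steinerSymmetral u K)) y) ≤
      2 * ENNReal.ofReal |(sectionTop u K y + sectionBot u K y) / 2 - c| := by
  change volume (symmDiff (lineSection u K y)
    (lineSection u ((c • u) +ᵥ steinerSymmetral u K) y)) ≤ _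
  have hle := sectionBot_le_sectionTop hu hK hy
  have h1 : lineSection u ((c • u) +ᵥ steinerSymmetral u K) y =
      Set.Icc (sectionBot u K y + (c - (sectionTop u K y + sectionBot u K y) / 2))
        (sectionTop u K y + (c - (sectionTop u K y + sectionBot u K y) / 2)) := by
    ext s
    rw [lineSection_vadd, Set.mem_vadd_set_iff_neg_vadd_mem,
      mem_lineSection_steinerSymmetral hu, volume_lineSection hu hK hKc hy,
      ENNReal.toReal_ofReal (sub_nonneg.2 hle), abs_le, vadd_eq_add]
    constructor
    · rintro ⟨-, h2, h3⟩
      constructor <;> linarith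
    · rintro ⟨h2, h3⟩
      exact ⟨hy, by linarith, by linarith⟩
  rw [h1, lineSection_eq_Icc hu hK hKc hy, abs_sub_comm]
  exact volume_symmDiff_Icc_le _ _ _

theorem setLIntegral_compl_volume_lineSection_le (hu : ‖u‖ = 1) (hK : IsCompact K)
    (hKc : Convex ℝ K) (h0 : (0 : EuclideanSpace ℝ (Fin n)) ∈ K) (hε : 0 < ε) (hε1 : ε < 1) :
    ∫⁻ y in ((1 - ε) • interior (shadow u K))ᶜ, volume (lineSection u K y) ≤
      ENNReal.ofReal (n * ε * (volume K).toReal) := by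
  set Q := (1 - ε) • interior (shadow u K)
  have hε' : 0 < 1 - ε := sub_pos.2 hε1
  have hQo : IsOpen Q := isOpen_interior.smul₀ hε'.ne'
  set M := (1 - ε) • interior K
  have hMo : IsOpen M := isOpen_interior.smul₀ hε'.ne'
  have hMK : M ⊆ K := by
    rintro _ ⟨k, hk, rfl⟩
    exact hKc.smul_mem_of_zero_mem h0 (interior_subset hk) ⟨hε'.le, by linarith⟩
  have hMQ : ∀ y ∉ Q, lineSection u M y = ∅ := by
    intro y hy
    by_contra hne
    obtain ⟨s, k, hk, hks⟩ := Set.nonempty_iff_ne_empty.2 hne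
    refine hy ⟨(1 - ε)⁻¹ • y, mem_shadow_of_mem_interior (s := (1 - ε)⁻¹ * s) ?_,
      smul_inv_smul₀ hε'.ne' y⟩
    have : (((1 - ε)⁻¹ • y : (ℝ ∙ u)ᗮ) : EuclideanSpace ℝ (Fin n)) + ((1 - ε)⁻¹ * s) • u = k := by
      rw [← inv_smul_smul₀ hε'.ne' k]
      change _ = (1 - ε)⁻¹ • ((fun x => (1 - ε) • x) k)
      rw [hks, smul_add, smul_smul]
      rfl
    rwa [this]
  have hKfin : volume K ≠ ⊤ := hK.measure_lt_top.ne
  have hMvol : volume M = ENNReal.ofReal ((1 - ε) ^ n * (volume K).toReal) := by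
    have hint : volume (interior K) = volume K :=
      measure_congr (interior_ae_eq_of_null_frontier (hKc.addHaar_frontier volume))
    rw [Measure.addHaar_smul, finrank_euclideanSpace_fin, hint, abs_of_nonneg (by positivity),
      ENNReal.ofReal_mul (by positivity), ENNReal.ofReal_toReal hKfin]
  have hMle : volume M ≤ ∫⁻ y in Q, volume (lineSection u K y) := by
    rw [volume_eq_lintegral_lineSection hu hMo.measurableSet, ← lintegral_add_compl _
      hQo.measurableSet]
    have : ∫⁻ y in Qᶜ, volume (lineSection u M y) = 0 := by
      rw [setLIntegral_congr_fun hQo.measurableSet.compl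
        (g := fun _ => 0) fun y hy => by simp [hMQ y hy]]
      simp
    rw [this, add_zero]
    exact lintegral_mono fun y => measure_mono fun s hs => hMK hs
  have hsum := lintegral_add_compl (μ := volume) (fun y => volume (lineSection u K y))
    hQo.measurableSet
  rw [← volume_eq_lintegral_lineSection hu hK.measurableSet] at hsum
  have hber : 1 - n * ε ≤ (1 - ε) ^ n := by
    have := one_add_mul_le_pow (show (-2 : ℝ) ≤ -ε by linarith) n
    rw [← sub_eq_add_neg] at this
    linarith
  have hcancel : volume M + ∫⁻ y in Qᶜ, volume (lineSection u K y) ≤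
      volume M + ENNReal.ofReal (n * ε * (volume K).toReal) := by
    refine (add_le_add_left hMle _).trans (hsum.le.trans ?_)
    rw [hMvol, ← ENNReal.ofReal_add (by positivity) (by positivity),
      ENNReal.le_ofReal_iff_toReal_le hKfin (by positivity)]
    nlinarith [ENNReal.toReal_nonneg (a := volume K)]
  exact (ENNReal.add_le_add_iff_left (by rw [hMvol]; exact ENNReal.ofReal_ne_top)).1 hcancel

theorem exists_volume_symmDiff_le {S S' : ℝ} (hu : ‖u‖ = 1) (hK : IsCompact K)
    (hKc : Convex ℝ K) (hr : 0 < r) (hrR : r ≤ R)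
    (hrK : r • closedBall (0 : EuclideanSpace ℝ (Fin n)) 1 ⊆ K)
    (hKR : K ⊆ R • closedBall (0 : EuclideanSpace ℝ (Fin n)) 1)
    (hS : Tendsto (fun t : ℝ =>
        ((volume (K + t • closedBall (0 : EuclideanSpace ℝ (Fin n)) 1)).toReal -
          (volume K).toReal) / t) (nhdsWithin 0 (Set.Ioi 0)) (nhds S))
    (hS' : Tendsto (fun t : ℝ =>
        ((volume (steinerSymmetral u K + t • closedBall (0 : EuclideanSpace ℝ (Fin n)) 1)).toReal -
          (volume (steinerSymmetral u K)).toReal) / t) (nhdsWithin 0 (Set.Ioi 0)) (nhds S'))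
    (hε : 0 < ε) (hε1 : ε < 1) {τ : ℝ} (hτ : 0 < τ) :
    ∃ c : ℝ, (volume (symmDiff K ((c • u) +ᵥ steinerSymmetral u K))).toReal ≤
      16 * R * (R / (ε * r) * τ * (S - S') + R / (ε * r) / τ * S) +
        2 * (n * ε * (volume K).toReal) := by
  obtain ⟨c, hc⟩ := exists_lintegral_abs_midpoint_sub_le hu hK hKc hr hrR hrK hKR hS hS' hε hε1 hτ
  have h0 : (0 : EuclideanSpace ℝ (Fin n)) ∈ K := hrK ⟨0, by simp, by simp⟩
  have hcomp := setLIntegral_compl_volume_lineSection_le hu hK hKc h0 hε hε1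
  have hS0 := surfaceArea_nonneg hK hS
  have hSS := sub_nonneg.2 (surfaceArea_steinerSymmetral_le hu hK hKc hS hS')
  have hR : 0 < R := hr.trans_le hrR
  refine ⟨c, ENNReal.toReal_le_of_le_ofReal (by positivity) ?_⟩
  set Q := (1 - ε) • interior (shadow u K)
  have hQo : IsOpen Q := isOpen_interior.smul₀ (sub_pos.2 hε1).ne'
  have hQP : Q ⊆ shadow u K := fun y hy =>
    closedBall_subset_of_mem_smul_interior (concaveOn_sectionTop hu hK hKc).1
      (closedBall_subset_shadow hr hrK) hε hε1 hy (mem_closedBall_self (by positivity))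
  have hTm : MeasurableSet ((c • u) +ᵥ steinerSymmetral u K) :=
    ((isCompact_steinerSymmetral hu hK hKc).vadd _).measurableSet
  rw [volume_eq_lintegral_lineSection hu (hK.measurableSet.symmDiff hTm),
    ← lintegral_add_compl _ hQo.measurableSet]
  calc _ ≤ (∫⁻ y in Q, 2 * ENNReal.ofReal |(sectionTop u K y + sectionBot u K y) / 2 - c|) +
        ∫⁻ y in Qᶜ, 2 * volume (lineSection u K y) := by
        refine add_le_add (setLIntegral_mono' hQo.measurableSet fun y hy =>
          volume_lineSection_symmDiff_le_abs hu hK hKc c (hQP hy)) (lintegral_mono fun y =>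
          volume_lineSection_symmDiff_le hu hK c y)
    _ ≤ 2 * ENNReal.ofReal (8 * R * (R / (ε * r) * τ * (S - S') + R / (ε * r) / τ * S)) +
        2 * ENNReal.ofReal (n * ε * (volume K).toReal) := by
        rw [lintegral_const_mul' _ _ ENNReal.ofNat_ne_top,
          lintegral_const_mul' _ _ ENNReal.ofNat_ne_top]
        gcongr
    _ = _ := by
        have h2 : ∀ a : ℝ, 2 * ENNReal.ofReal a = ENNReal.ofReal (2 * a) := fun a => by
          rw [ENNReal.ofReal_mul zero_le_two, ENNReal.ofReal_ofNat]
        rw [h2, h2, ← ENNReal.ofReal_add (by positivity) (by positivity)]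
        congr 1
        ring

end SymmetricDifference

section Nikodym

variable {n : ℕ} {u : EuclideanSpace ℝ (Fin n)} {K : Set (EuclideanSpace ℝ (Fin n))} {r R : ℝ}

theorem toReal_volume_pos (hK : IsCompact K) (hr : 0 < r)
    (hrK : r • closedBall (0 : EuclideanSpace ℝ (Fin n)) 1 ⊆ K) : 0 < (volume K).toReal := by
  refine ENNReal.toReal_pos (ne_of_gt ?_) hK.measure_lt_top.ne
  refine lt_of_lt_of_le (measure_ball_pos volume (0 : EuclideanSpace ℝ (Fin n)) hr)
    (measure_mono ?_)
  rw [smul_unitClosedBall, Real.norm_of_nonneg hr.le] at hrK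
  exact ball_subset_closedBall.trans hrK

theorem nikodym_nonneg (K T : Set (EuclideanSpace ℝ (Fin n))) : 0 ≤ nikodym K T :=
  Real.iInf_nonneg fun _ => by positivity

theorem nikodym_steinerSymmetral_le (hu : ‖u‖ = 1) (hK : IsCompact K) (hKc : Convex ℝ K)
    (hK0 : 0 < (volume K).toReal) (x : EuclideanSpace ℝ (Fin n)) :
    nikodym K (steinerSymmetral u K) ≤
      (volume (symmDiff K (x +ᵥ steinerSymmetral u K))).toReal / (volume K).toReal := by
  have hbdd : BddBelow (Set.range fun x₀ : EuclideanSpace ℝ (Fin n) =>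
      (volume (symmDiff ((((volume (steinerSymmetral u K)).toReal / (volume K).toReal) ^
        ((1 : ℝ) / n)) • K) (x₀ +ᵥ steinerSymmetral u K))).toReal /
          (volume (steinerSymmetral u K)).toReal) :=
    ⟨0, by rintro _ ⟨x, rfl⟩; positivity⟩
  refine (ciInf_le hbdd x).trans (le_of_eq ?_)
  rw [volume_steinerSymmetral hu hK hKc, div_self hK0.ne', Real.one_rpow, one_smul]

theorem nikodym_steinerSymmetral_le_two (hu : ‖u‖ = 1) (hK : IsCompact K) (hKc : Convex ℝ K)
    (hK0 : 0 < (volume K).toReal) : nikodym K (steinerSymmetral u K) ≤ 2 := by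
  refine (nikodym_steinerSymmetral_le hu hK hKc hK0 0).trans ?_
  rw [div_le_iff₀ hK0, zero_vadd]
  have h := volume_symmDiff_le volume K (steinerSymmetral u K)
  rw [volume_steinerSymmetral hu hK hKc] at h
  have hfin : volume K ≠ ⊤ := hK.measure_lt_top.ne
  have h2 := ENNReal.toReal_mono (ENNReal.add_ne_top.2 ⟨hfin, hfin⟩) h
  rw [ENNReal.toReal_add hfin hfin] at h2
  linarith

theorem nikodym_steinerSymmetral_le_mul {S S' : ℝ} (hn : 0 < n) (hu : ‖u‖ = 1) (hK : IsCompact K)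
    (hKc : Convex ℝ K) (hr : 0 < r) (hrR : r ≤ R)
    (hrK : r • closedBall (0 : EuclideanSpace ℝ (Fin n)) 1 ⊆ K)
    (hKR : K ⊆ R • closedBall (0 : EuclideanSpace ℝ (Fin n)) 1)
    (hS : Tendsto (fun t : ℝ =>
        ((volume (K + t • closedBall (0 : EuclideanSpace ℝ (Fin n)) 1)).toReal -
          (volume K).toReal) / t) (nhdsWithin 0 (Set.Ioi 0)) (nhds S))
    (hS' : Tendsto (fun t : ℝ =>
        ((volume (steinerSymmetral u K + t • closedBall (0 : EuclideanSpace ℝ (Fin n)) 1)).toReal -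
          (volume (steinerSymmetral u K)).toReal) / t) (nhdsWithin 0 (Set.Ioi 0)) (nhds S'))
    {h : ℝ} (hh : 0 < h) (hδ : S - S' ≤ h ^ 4 * S) :
    nikodym K (steinerSymmetral u K) ≤ 34 * (n * R / r) * h := by
  have hK0 := toReal_volume_pos hK hr hrK
  have hR : 0 < R := hr.trans_le hrR
  have hn1 : (1 : ℝ) ≤ n := by exact_mod_cast hn
  rcases le_or_gt 1 (R / r * h) with h1 | h1
  · refine (nikodym_steinerSymmetral_le_two hu hK hKc hK0).trans ?_
    have : 34 * (n * R / r) * h = 34 * n * (R / r * h) := by ring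
    rw [this]
    nlinarith
  have hε : 0 < R / r * h := by positivity
  obtain ⟨c, hc⟩ := exists_volume_symmDiff_le hu hK hKc hr hrR hrK hKR hS hS' hε h1
    (show 0 < 1 / h ^ 2 by positivity)
  refine (nikodym_steinerSymmetral_le hu hK hKc hK0 (c • u)).trans ?_
  rw [div_le_iff₀ hK0]
  refine hc.trans ?_
  have hS0 := surfaceArea_nonneg hK hS
  have hSle := surfaceArea_le hK hKc hr hrK hS
  have hcoef : R / (R / r * h * r) = 1 / h := by field_simp
  rw [hcoef]
  have h2 : 1 / h * (1 / h ^ 2) * (S - S') ≤ h * S := by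
    calc 1 / h * (1 / h ^ 2) * (S - S') ≤ 1 / h * (1 / h ^ 2) * (h ^ 4 * S) := by gcongr
      _ = h * S := by field_simp
  have h3 : 1 / h / (1 / h ^ 2) * S = h * S := by field_simp
  rw [h3]
  calc 16 * R * (1 / h * (1 / h ^ 2) * (S - S') + h * S) +
        2 * (n * (R / r * h) * (volume K).toReal)
      ≤ 16 * R * (h * S + h * S) + 2 * (n * (R / r * h) * (volume K).toReal) := by gcongr
    _ = 32 * R * h * S + 2 * (n * (R / r * h) * (volume K).toReal) := by ring
    _ ≤ 32 * R * h * (n / r * (volume K).toReal) + 2 * (n * (R / r * h) * (volume K).toReal) := by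
        gcongr
    _ = 34 * (n * R / r) * h * (volume K).toReal := by ring

end Nikodym

theorem le_rpow_of_le_two_of_le_mul {A N δ lam : ℝ} (hA : 0 ≤ A) (hA2 : A ≤ 2) (hN : 1 ≤ N)
    (hδ : 0 ≤ δ) (hAN : A ≤ 34 * N * δ ^ (1 / 4 : ℝ)) (hlam : 2 < lam) :
    A ≤ 68 * N ^ (1 + 1 / lam) * δ ^ (1 / (2 * lam)) := by
  have hlam0 : 0 < lam := by linarith
  have hθ : 2 / lam < 1 := by rwa [div_lt_one hlam0]
  have hθ0 : 0 < 2 / lam := by positivity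
  calc A = A ^ (1 - 2 / lam) * A ^ (2 / lam) := by
        rw [← Real.rpow_add_of_nonneg hA (by linarith) hθ0.le, sub_add_cancel, Real.rpow_one]
    _ ≤ 2 * (34 * N ^ (1 + 1 / lam) * δ ^ (1 / (2 * lam))) := by
        refine mul_le_mul ?_ ?_ (by positivity) zero_le_two
        · calc A ^ (1 - 2 / lam) ≤ 2 ^ (1 - 2 / lam) :=
                Real.rpow_le_rpow hA hA2 (by linarith)
            _ ≤ 2 ^ (1 : ℝ) := Real.rpow_le_rpow_of_exponent_le one_le_two (by linarith)
            _ = 2 := Real.rpow_one 2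
        · have hexp : 2 / lam ≤ 1 + 1 / lam := by
            have : 2 / lam = 1 / lam + 1 / lam := by ring
            have : 1 / lam ≤ 1 := by rw [div_le_one hlam0]; linarith
            linarith
          have e : (1 / 4 : ℝ) * (2 / lam) = 1 / (2 * lam) := by
            field_simp
            norm_num
          calc A ^ (2 / lam) ≤ (34 * N * δ ^ (1 / 4 : ℝ)) ^ (2 / lam) :=
                Real.rpow_le_rpow hA hAN hθ0.le
            _ = 34 ^ (2 / lam) * N ^ (2 / lam) * δ ^ (1 / (2 * lam)) := by
                rw [Real.mul_rpow (by positivity) (by positivity),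
                  Real.mul_rpow (by norm_num) (by positivity), ← Real.rpow_mul hδ, e]
            _ ≤ 34 ^ (1 : ℝ) * N ^ (1 + 1 / lam) * δ ^ (1 / (2 * lam)) := by
                gcongr
                norm_num
            _ = 34 * N ^ (1 + 1 / lam) * δ ^ (1 / (2 * lam)) := by rw [Real.rpow_one]
    _ = _ := by ring

/-- Stability of the Steiner symmetrization: with `β = (λ-2)/(λ-1)`,
`A(K, S_u K) ≤ C (1/β)^(1-1/λ) (nR/r)^(1+1/λ) δ_u(K)^(1/(2λ))`, where
`δ_u(K) = 1 - |∂S_u K|/|∂K|` and the surface areas are outer Minkowski contents. -/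
theorem steiner_stability :
    ∃ C : ℝ, 0 < C ∧ ∀ (n : ℕ), 2 ≤ n →
      ∀ (K : Set (EuclideanSpace ℝ (Fin n))) (r R : ℝ),
        IsCompact K → Convex ℝ K → 0 < r → r ≤ R →
        r • closedBall (0 : EuclideanSpace ℝ (Fin n)) 1 ⊆ K →
        K ⊆ R • closedBall (0 : EuclideanSpace ℝ (Fin n)) 1 →
        ∀ u : EuclideanSpace ℝ (Fin n), ‖u‖ = 1 →
        ∀ S S' : ℝ,
          Tendsto (fun t : ℝ =>
              ((volume (K + t • closedBall (0 : EuclideanSpace ℝ (Fin n)) 1)).toReal -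
                (volume K).toReal) / t)
            (nhdsWithin 0 (Set.Ioi 0)) (nhds S) →
          Tendsto (fun t : ℝ =>
              ((volume (steinerSymmetral u K +
                  t • closedBall (0 : EuclideanSpace ℝ (Fin n)) 1)).toReal -
                (volume (steinerSymmetral u K)).toReal) / t)
            (nhdsWithin 0 (Set.Ioi 0)) (nhds S') →
          ∀ lam : ℝ, lam ∈ Set.Ioi (2 : ℝ) →
            nikodym K (steinerSymmetral u K) ≤
              C * ((lam - 1) / (lam - 2)) ^ (1 - 1 / lam) *
                ((n : ℝ) * R / r) ^ (1 + 1 / lam) *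
                (1 - S' / S) ^ (1 / (2 * lam)) := by
  refine ⟨68, by norm_num, ?_⟩
  intro n hn K r R hK hKc hr hrR hrK hKR u hu S S' hS hS' lam hlam
  have hlam2 : 2 < lam := hlam
  have hK0 := toReal_volume_pos hK hr hrK
  have hR : 0 < R := hr.trans_le hrR
  have hn1 : (1 : ℝ) ≤ n := by exact_mod_cast one_le_two.trans hn
  have hN : 1 ≤ (n : ℝ) * R / r := by
    rw [one_le_div hr]
    nlinarith
  have hS0 := surfaceArea_nonneg hK hS
  have hSS := surfaceArea_steinerSymmetral_le hu hK hKc hS hS'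
  have hδ0 : 0 ≤ 1 - S' / S := sub_nonneg.2 (div_le_one_of_le₀ hSS hS0)
  have hmain : nikodym K (steinerSymmetral u K) ≤
      34 * (n * R / r) * (1 - S' / S) ^ (1 / 4 : ℝ) := by
    rcases hS0.eq_or_lt with h0 | h0
    · refine (nikodym_steinerSymmetral_le_two hu hK hKc hK0).trans ?_
      rw [← h0, div_zero, sub_zero, Real.one_rpow]
      linarith
    · refine ge_of_tendsto (x := nhdsWithin 0 (Set.Ioi 0)) (f := fun κ : ℝ =>
        34 * (n * R / r) * ((1 - S' / S) ^ (1 / 4 : ℝ) + κ)) ?_ ?_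
      · have : Continuous fun κ : ℝ => 34 * (n * R / r) * ((1 - S' / S) ^ (1 / 4 : ℝ) + κ) := by
          fun_prop
        simpa using (this.tendsto 0).mono_left nhdsWithin_le_nhds
      · filter_upwards [self_mem_nhdsWithin] with κ hκ
        have hκ0 : 0 < κ := hκ
        refine nikodym_steinerSymmetral_le_mul (by linarith) hu hK hKc hr hrR hrK hKR hS hS'
          (by positivity) ?_
        have h1 : 1 - S' / S ≤ ((1 - S' / S) ^ (1 / 4 : ℝ) + κ) ^ 4 := by
          calc 1 - S' / S = ((1 - S' / S) ^ (1 / 4 : ℝ)) ^ 4 := by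
                rw [← Real.rpow_natCast, ← Real.rpow_mul hδ0]
                norm_num
            _ ≤ _ := by gcongr; linarith
        calc S - S' = (1 - S' / S) * S := by field_simp
          _ ≤ _ := by gcongr
  have hβ : 1 ≤ ((lam - 1) / (lam - 2)) ^ (1 - 1 / lam) := by
    refine Real.one_le_rpow ?_ ?_
    · rw [one_le_div (by linarith)]
      linarith
    · rw [sub_nonneg, div_le_one (by linarith)]
      linarith
  refine (le_rpow_of_le_two_of_le_mul (nikodym_nonneg _ _)
    (nikodym_steinerSymmetral_le_two hu hK hKc hK0) hN hδ0 hmain hlam2).trans ?_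
  have hN' : 0 ≤ (n : ℝ) * R / r := by linarith
  gcongr
  linarith
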